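/- arXiv:1411.5639 — 6 statements merged into one kernel-verified Lean document; each statement's English description precedes it below -/
import Mathlib

section
/- Let X be a uniformly distributed random point on the unit sphere S^{N-1} ⊂ ℝ^N (N ≥ 2) and p a fixed point on the sphere. Then for 0 ≤ d ≤ √2, the probability that ‖X - p‖ ≤ d equals (1/2)·I_{d² - d⁴/4}((N-1)/2, 1/2), where I_x(a,b) is the regularized incomplete beta function. -/
open MeasureTheory Metric

/-- The uniform (normalized surface) probability measure on the unit sphere of
`ℝ^N`, viewed as a measure on the ambient space. -/
noncomputable def uniformOnSphere (N : ℕ) : Measure (EuclideanSpace ℝ (Fin N)) :=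
  (((volume : Measure (EuclideanSpace ℝ (Fin N))).toSphere Set.univ)⁻¹ •
    (volume : Measure (EuclideanSpace ℝ (Fin N))).toSphere).map Subtype.val

/-- The (incomplete) Euler beta integral `B(x; a, b)`. -/
noncomputable def incBeta (x a b : ℝ) : ℝ :=
  ∫ t in (0:ℝ)..x, t ^ (a - 1) * (1 - t) ^ (b - 1)

/-- The Euler Beta function `B(a,b) = B(1; a, b)`. -/
noncomputable def betaFn (a b : ℝ) : ℝ := incBeta 1 a b

/-- The regularized incomplete beta function `I_x(a,b)`. -/
noncomputable def regIncBeta (x a b : ℝ) : ℝ := incBeta x a b / betaFn a b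

theorem lintegral_comp_smul_addHaar {V : Type*} [NormedAddCommGroup V] [NormedSpace ℝ V]
    [MeasurableSpace V] [BorelSpace V] [FiniteDimensional ℝ V] (μ : Measure V)
    [μ.IsAddHaarMeasure] {F : V → ENNReal} (hF : Measurable F) {r : ℝ} (hr : 0 < r) :
    ∫⁻ z, F (r • z) ∂μ = ENNReal.ofReal (r ^ Module.finrank ℝ V)⁻¹ * ∫⁻ z, F z ∂μ := by
  rw [← lintegral_map hF (measurable_const_smul r), Measure.map_addHaar_smul μ hr.ne',
    lintegral_smul_measure, abs_of_pos (by positivity), smul_eq_mul]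

/-- The volume of the part of the unit ball of `ℝ × V` seen under the slopes in `T`. -/
theorem prod_measure_ball_slope_mem {V : Type*} [NormedAddCommGroup V] [NormedSpace ℝ V]
    [MeasurableSpace V] [BorelSpace V] [FiniteDimensional ℝ V] [Nontrivial V] (μ : Measure V)
    [μ.IsAddHaarMeasure] {T : Set ℝ} (hT : MeasurableSet T) :
    ((volume : Measure ℝ).prod μ) {x | x.1 ^ 2 + ‖x.2‖ ^ 2 < 1 ∧ x.1 / ‖x.2‖ ∈ T} =
      (∫⁻ z in ball 0 1, ENNReal.ofReal ‖z‖ ∂μ) *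
        ∫⁻ w in T, ENNReal.ofReal (√(1 + w ^ 2) ^ (Module.finrank ℝ V + 1))⁻¹ := by
  have hk : ∀ w : ℝ, 0 < √(1 + w ^ 2) := fun w ↦ by positivity
  set F : V → ENNReal := (ball 0 1).indicator fun z ↦ ENNReal.ofReal ‖z‖ with hF
  have hFm : Measurable F := by
    apply Measurable.indicator _ measurableSet_ball
    fun_prop
  have hmeas : MeasurableSet {x : ℝ × V | x.1 ^ 2 + ‖x.2‖ ^ 2 < 1 ∧ x.1 / ‖x.2‖ ∈ T} := by
    have h : Measurable fun x : ℝ × V ↦ x.1 ^ 2 + ‖x.2‖ ^ 2 := by fun_prop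
    refine (measurableSet_lt h measurable_const).inter ?_
    exact (measurable_fst.div measurable_snd.norm) hT
  have hslice : ∀ z : V, z ≠ 0 →
      volume ((fun s : ℝ ↦ (s, z)) ⁻¹' {x | x.1 ^ 2 + ‖x.2‖ ^ 2 < 1 ∧ x.1 / ‖x.2‖ ∈ T}) =
        ∫⁻ w in T, ENNReal.ofReal (√(1 + w ^ 2))⁻¹ * F (√(1 + w ^ 2) • z) := by
    intro z hz
    have hz' : 0 < ‖z‖ := norm_pos_iff.2 hz
    have hset : (fun s : ℝ ↦ (s, z)) ⁻¹' {x | x.1 ^ 2 + ‖x.2‖ ^ 2 < 1 ∧ x.1 / ‖x.2‖ ∈ T} =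
        (fun s : ℝ ↦ ‖z‖⁻¹ • s) ⁻¹' ({w | √(1 + w ^ 2) • z ∈ ball 0 1} ∩ T) := by
      ext s
      have h1 : ‖z‖⁻¹ * s = s / ‖z‖ := by ring
      have h2 : s ^ 2 + ‖z‖ ^ 2 = (√(1 + (s / ‖z‖) ^ 2) * ‖z‖) ^ 2 := by
        rw [mul_pow, Real.sq_sqrt (by positivity)]
        field_simp
        ring
      simp only [Set.mem_preimage, Set.mem_ofPred_eq, Set.mem_inter_iff, smul_eq_mul, h1, h2,
        mem_ball_zero_iff, norm_smul, Real.norm_eq_abs, abs_of_pos (hk _)]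
      rw [sq_lt_one_iff₀ (by positivity)]
    have hball : MeasurableSet {w : ℝ | √(1 + w ^ 2) • z ∈ ball 0 1} := by
      have : Measurable fun w : ℝ ↦ √(1 + w ^ 2) • z := by fun_prop
      exact this measurableSet_ball
    rw [hset, Measure.addHaar_preimage_smul _ (by positivity)]
    rw [← Measure.restrict_apply hball, ← lintegral_indicator_one hball,
      ← lintegral_const_mul _ (measurable_one.indicator hball)]
    refine lintegral_congr fun w ↦ ?_
    by_cases hw : √(1 + w ^ 2) • z ∈ ball 0 1
    · rw [Set.indicator_of_mem (s := {w : ℝ | √(1 + w ^ 2) • z ∈ ball 0 1}) hw, hF,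
        Set.indicator_of_mem hw, ← ENNReal.ofReal_mul (by positivity), norm_smul, Real.norm_eq_abs,
        abs_of_pos (hk _), inv_mul_cancel_left₀ (hk w).ne']
      simp
    · rw [Set.indicator_of_notMem (s := {w : ℝ | √(1 + w ^ 2) • z ∈ ball 0 1}) hw, hF,
        Set.indicator_of_notMem hw]
      simp
  have hcomp : Measurable fun x : V × ℝ ↦
      ENNReal.ofReal (√(1 + x.2 ^ 2))⁻¹ * F (√(1 + x.2 ^ 2) • x.1) := by
    refine Measurable.mul (by fun_prop) (hFm.comp ?_)
    fun_prop
  have hne : ∀ᵐ z ∂μ, z ≠ 0 := by simp [ae_iff]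
  rw [Measure.prod_apply_symm hmeas,
    lintegral_congr_ae (hne.mono hslice), lintegral_lintegral_swap hcomp.aemeasurable,
    ← lintegral_const_mul _ (by fun_prop)]
  refine lintegral_congr fun w ↦ ?_
  rw [lintegral_const_mul' _ _ ENNReal.ofReal_ne_top,
    lintegral_comp_smul_addHaar μ hFm (hk w), ← mul_assoc, ← ENNReal.ofReal_mul (by positivity),
    hF, lintegral_indicator measurableSet_ball, mul_comm,
    pow_succ (√(1 + w ^ 2)), mul_inv, mul_comm (√(1 + w ^ 2))⁻¹]

theorem exists_measurePreserving_inner_norm {n : ℕ} {p : EuclideanSpace ℝ (Fin (n + 1))}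
    (hp : ‖p‖ = 1) :
    ∃ Φ : EuclideanSpace ℝ (Fin (n + 1)) → ℝ × EuclideanSpace ℝ (Fin n),
      MeasurePreserving Φ ∧
        ∀ y, (Φ y).1 = inner ℝ p y ∧ (Φ y).1 ^ 2 + ‖(Φ y).2‖ ^ 2 = ‖y‖ ^ 2 := by
  obtain ⟨b, hb⟩ := Orthonormal.exists_orthonormalBasis_extension_of_card_eq (𝕜 := ℝ)
    (E := EuclideanSpace ℝ (Fin (n + 1))) (ι := Fin (n + 1)) (by simp)
    (v := fun _ ↦ p) (s := {0}) ⟨fun _ ↦ hp, fun i j hij ↦ (hij (Subsingleton.elim i j)).elim⟩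
  have hb0 : b 0 = p := hb 0 rfl
  refine ⟨fun y ↦ Prod.map id (WithLp.toLp 2)
    (MeasurableEquiv.piFinSuccAbove (fun _ ↦ ℝ) 0 (b.repr y).ofLp), ?_, fun y ↦ ⟨?_, ?_⟩⟩
  · exact ((MeasurePreserving.id volume).prod (PiLp.volume_preserving_toLp (Fin n))).comp
      ((volume_preserving_piFinSuccAbove (fun _ ↦ ℝ) 0).comp
        ((PiLp.volume_preserving_ofLp (Fin (n + 1))).comp b.measurePreserving_repr))
  · simp [b.repr_apply_apply, hb0, MeasurableEquiv.piFinSuccAbove]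
  · rw [← b.repr.norm_map y, EuclideanSpace.real_norm_sq_eq, EuclideanSpace.real_norm_sq_eq,
      Fin.sum_univ_succ]
    simp [MeasurableEquiv.piFinSuccAbove, Fin.tail]

theorem lintegral_slopes_eq_lintegral_beta (n : ℕ) {x : ℝ} (hx : x ≤ 1) :
    ∫⁻ w in {w : ℝ | 0 < w ∧ (1 + w ^ 2)⁻¹ ≤ x}, ENNReal.ofReal (√(1 + w ^ 2) ^ (n + 1))⁻¹ =
      2⁻¹ * ∫⁻ t in Set.Ioc 0 x,
        ENNReal.ofReal (t ^ ((n : ℝ) / 2 - 1) * (1 - t) ^ ((1 / 2 : ℝ) - 1)) := by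
  set S : Set ℝ := {w : ℝ | 0 < w ∧ (1 + w ^ 2)⁻¹ ≤ x}
  have hg : Measurable fun w : ℝ ↦ (1 + w ^ 2)⁻¹ := by fun_prop
  have hS : MeasurableSet S := measurableSet_Ioi.inter (measurableSet_le hg measurable_const)
  have himage : (fun w : ℝ ↦ (1 + w ^ 2)⁻¹) '' S =ᵐ[volume] Set.Ioc 0 x := by
    have : (fun w : ℝ ↦ (1 + w ^ 2)⁻¹) '' S = Set.Ioc 0 x \ {1} := by
      ext t
      constructor
      · rintro ⟨w, ⟨hw0, hw⟩, rfl⟩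
        refine ⟨⟨by positivity, hw⟩, ?_⟩
        simp [hw0.ne']
      · rintro ⟨⟨ht0, ht⟩, ht1 : t ≠ 1⟩
        have ht1 : t < 1 := lt_of_le_of_ne (ht.trans hx) ht1
        have h : 0 < t⁻¹ - 1 := sub_pos.2 ((one_lt_inv₀ ht0).2 ht1)
        have he : (1 + √(t⁻¹ - 1) ^ 2)⁻¹ = t := by rw [Real.sq_sqrt h.le]; simp
        exact ⟨√(t⁻¹ - 1), ⟨Real.sqrt_pos.2 h, he.le.trans ht⟩, he⟩
    rw [this]
    exact sdiff_null_ae_eq_self (by simp)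
  have hderiv : ∀ w ∈ S, HasDerivWithinAt (fun w : ℝ ↦ (1 + w ^ 2)⁻¹)
      (-(2 * w) / (1 + w ^ 2) ^ 2) S w := fun w _ ↦ by
    have := (((hasDerivAt_id w).pow 2).const_add 1).inv (by simp; positivity)
    simpa using! this.hasDerivWithinAt
  have hinj : Set.InjOn (fun w : ℝ ↦ (1 + w ^ 2)⁻¹) S := by
    rintro a ⟨ha, -⟩ b ⟨hb, -⟩ hab
    have : a ^ 2 = b ^ 2 := by simpa using hab
    exact (pow_left_inj₀ ha.le hb.le two_ne_zero).1 this
  rw [← setLIntegral_congr himage, lintegral_image_eq_lintegral_abs_deriv_mul hS hderiv hinj,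
    ← lintegral_const_mul' _ _ (by simp)]
  refine setLIntegral_congr_fun hS fun w hw ↦ ?_
  have hw0 : 0 < w := hw.1
  have hu : 0 < 1 + w ^ 2 := by positivity
  have h2 : (2⁻¹ : ENNReal) = ENNReal.ofReal 2⁻¹ := by
    rw [ENNReal.ofReal_inv_of_pos two_pos]; simp
  rw [h2, ← ENNReal.ofReal_mul (by positivity), ← ENNReal.ofReal_mul (by positivity)]
  congr 1
  have hsub : 1 - (1 + w ^ 2)⁻¹ = w ^ 2 * (1 + w ^ 2)⁻¹ := by field_simp; ring
  rw [abs_div, abs_neg, abs_of_pos (by positivity), abs_of_pos (by positivity), hsub,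
    Real.mul_rpow (by positivity) (by positivity), ← Real.rpow_natCast w 2, ← Real.rpow_mul hw0.le,
    Real.sqrt_eq_rpow, ← Real.rpow_natCast, ← Real.rpow_mul (by positivity), ← Real.rpow_neg_one,
    Real.rpow_natCast]
  generalize hU : 1 + w ^ 2 = u at hu
  rw [← Real.rpow_neg_one u, ← Real.rpow_mul hu.le, ← Real.rpow_mul hu.le, ← Real.rpow_mul hu.le]
  norm_num [Real.rpow_neg_one]
  field_simp
  rw [← Real.rpow_add hu, ← Real.rpow_natCast, ← Real.rpow_add hu]
  norm_num
  ring_nf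

open scoped Pointwise in
theorem uniformOnSphere_apply {n : ℕ} {S : Set (EuclideanSpace ℝ (Fin (n + 1)))}
    (hS : MeasurableSet S) :
    uniformOnSphere (n + 1) S =
      (volume (ball (0 : EuclideanSpace ℝ (Fin (n + 1))) 1))⁻¹ *
        volume {y : EuclideanSpace ℝ (Fin (n + 1)) | 0 < ‖y‖ ∧ ‖y‖ < 1 ∧ ‖y‖⁻¹ • y ∈ S} := by
  have hset : Set.Ioo (0 : ℝ) 1 • (Subtype.val '' (Subtype.val ⁻¹' S :
      Set (sphere (0 : EuclideanSpace ℝ (Fin (n + 1))) 1))) =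
      {y | 0 < ‖y‖ ∧ ‖y‖ < 1 ∧ ‖y‖⁻¹ • y ∈ S} := by
    ext y
    constructor
    · rintro ⟨r, ⟨hr0, hr1⟩, _, ⟨⟨u, hu⟩, huS, rfl⟩, rfl⟩
      have hu1 : ‖u‖ = 1 := by simpa using hu
      have hr : ‖r • u‖ = r := by simp [norm_smul, hu1, abs_of_pos hr0]
      refine ⟨hr.symm ▸ hr0, hr.symm ▸ hr1, ?_⟩
      simpa [hr, smul_smul, hr0.ne'] using huS
    · rintro ⟨h0, h1, hS⟩
      refine ⟨‖y‖, ⟨h0, h1⟩, ‖y‖⁻¹ • y, ⟨⟨‖y‖⁻¹ • y, ?_⟩, hS, rfl⟩, ?_⟩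
      · simp [norm_smul, h0.ne']
      · simp [smul_smul, h0.ne']
  rw [uniformOnSphere, Measure.map_apply measurable_subtype_coe hS, Measure.smul_apply,
    Measure.toSphere_apply_univ, Measure.toSphere_apply' _ (measurable_subtype_coe hS), hset,
    smul_eq_mul, ENNReal.mul_inv (by simp) (by simp), mul_mul_mul_comm, mul_comm,
    mul_comm (volume _)⁻¹]
  rw [ENNReal.inv_mul_cancel (by simp) (by simp), mul_one, mul_comm]

theorem volume_ball_inter_slope_mem {m : ℕ} {p : EuclideanSpace ℝ (Fin (m + 2))} (hp : ‖p‖ = 1)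
    {T : Set ℝ} (hT : MeasurableSet T) {S : Set (EuclideanSpace ℝ (Fin (m + 2)))}
    (hS : ∀ y, ∀ q > 0, ‖y‖ ^ 2 = inner ℝ p y ^ 2 + q ^ 2 → inner ℝ p y ≠ 0 →
      (y ∈ S ↔ ‖y‖ < 1 ∧ inner ℝ p y / q ∈ T)) :
    volume S = (∫⁻ z in ball (0 : EuclideanSpace ℝ (Fin (m + 1))) 1, ENNReal.ofReal ‖z‖) *
      ∫⁻ w in T, ENNReal.ofReal (√(1 + w ^ 2) ^ (m + 2))⁻¹ := by
  obtain ⟨Φ, hΦ, h⟩ := exists_measurePreserving_inner_norm hp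
  have key := prod_measure_ball_slope_mem
    (volume : Measure (EuclideanSpace ℝ (Fin (m + 1)))) hT
  rw [finrank_euclideanSpace_fin] at key
  rw [← key]
  have hmeas : MeasurableSet {x : ℝ × EuclideanSpace ℝ (Fin (m + 1)) |
      x.1 ^ 2 + ‖x.2‖ ^ 2 < 1 ∧ x.1 / ‖x.2‖ ∈ T} := by
    have h : Measurable fun x : ℝ × EuclideanSpace ℝ (Fin (m + 1)) ↦ x.1 ^ 2 + ‖x.2‖ ^ 2 := by
      fun_prop
    exact (measurableSet_lt h measurable_const).inter ((measurable_fst.div measurable_snd.norm) hT)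
  have hfst : ∀ᵐ y, (Φ y).1 ≠ 0 :=
    (Measure.quasiMeasurePreserving_fst.comp hΦ.quasiMeasurePreserving).ae
      (p := fun s : ℝ ↦ s ≠ 0) (by simp [ae_iff])
  have hsnd : ∀ᵐ y, (Φ y).2 ≠ 0 :=
    (Measure.quasiMeasurePreserving_snd.comp hΦ.quasiMeasurePreserving).ae
      (p := fun z : EuclideanSpace ℝ (Fin (m + 1)) ↦ z ≠ 0) (by simp [ae_iff])
  rw [← Measure.volume_eq_prod, ← hΦ.measure_preimage hmeas.nullMeasurableSet]
  refine measure_congr ?_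
  filter_upwards [hfst, hsnd] with y h1 h2
  obtain ⟨ha, hb⟩ := h y
  rw [ha] at h1 hb
  refine propext ((hS y ‖(Φ y).2‖ (norm_pos_iff.2 h2) hb.symm h1).trans ?_)
  change _ ↔ (Φ y).1 ^ 2 + ‖(Φ y).2‖ ^ 2 < 1 ∧ (Φ y).1 / ‖(Φ y).2‖ ∈ T
  rw [ha, hb, sq_lt_one_iff₀ (norm_nonneg _)]

theorem mul_le_iff_slope {c s r q : ℝ} (hc : 0 ≤ c) (hr : 0 ≤ r) (hq : 0 < q)
    (h : r ^ 2 = s ^ 2 + q ^ 2) (hs : s ≠ 0) :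
    c * r ≤ s ↔ 0 < s / q ∧ (1 + (s / q) ^ 2)⁻¹ ≤ 1 - c ^ 2 := by
  have hpos : 0 < s ^ 2 + q ^ 2 := by positivity
  have h1 : (1 + (s / q) ^ 2)⁻¹ = q ^ 2 / (s ^ 2 + q ^ 2) := by field_simp; ring
  rw [h1, div_le_iff₀ hpos, div_pos_iff_of_pos_right hq]
  constructor
  · intro hcr
    have hs' : 0 ≤ s := le_trans (by positivity) hcr
    refine ⟨lt_of_le_of_ne hs' hs.symm, ?_⟩
    have := pow_le_pow_left₀ (by positivity) hcr 2
    rw [mul_pow, h] at this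
    linarith
  · rintro ⟨hs', hle⟩
    refine (sq_le_sq₀ (by positivity) hs'.le).1 ?_
    rw [mul_pow, h]
    linarith

theorem norm_inv_smul_sub_le_iff {E : Type*} [NormedAddCommGroup E] [InnerProductSpace ℝ E]
    {p y : E} (hp : ‖p‖ = 1) (hy : 0 < ‖y‖) {d : ℝ} (hd : 0 ≤ d) :
    ‖‖y‖⁻¹ • y - p‖ ≤ d ↔ (1 - d ^ 2 / 2) * ‖y‖ ≤ inner ℝ p y := by
  have hu : ‖‖y‖⁻¹ • y‖ = 1 := by simp [norm_smul, hy.ne']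
  rw [← sq_le_sq₀ (norm_nonneg _) hd, norm_sub_sq_real, hu, hp, real_inner_smul_left,
    real_inner_comm, ← le_div_iff₀ hy, div_eq_inv_mul (inner ℝ p y)]
  constructor <;> intro h <;> linarith

theorem lintegral_slopes_univ (n : ℕ) :
    ∫⁻ w in Set.univ, ENNReal.ofReal (√(1 + w ^ 2) ^ (n + 1))⁻¹ =
      ∫⁻ t in Set.Ioc 0 1,
        ENNReal.ofReal (t ^ ((n : ℝ) / 2 - 1) * (1 - t) ^ ((1 / 2 : ℝ) - 1)) := by
  have hset : {w : ℝ | 0 < w ∧ (1 + w ^ 2)⁻¹ ≤ 1} = Set.Ioi 0 := by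
    ext w
    have : (1 + w ^ 2)⁻¹ ≤ 1 := inv_le_one_of_one_le₀ (by nlinarith [sq_nonneg w])
    simp [this]
  have h := lintegral_slopes_eq_lintegral_beta n le_rfl
  rw [hset] at h
  have hneg := (Measure.measurePreserving_neg (volume : Measure ℝ)).setLIntegral_comp_preimage
    measurableSet_Ioi (s := Set.Ioi (0 : ℝ))
    (f := fun w ↦ ENNReal.ofReal (√(1 + w ^ 2) ^ (n + 1))⁻¹) (by fun_prop)
  have hpre : (Neg.neg ⁻¹' Set.Ioi (0 : ℝ)) = Set.Iio 0 := by ext; simp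
  simp only [neg_sq, hpre] at hneg
  rw [Measure.restrict_univ, ← lintegral_add_compl _ (measurableSet_Ioi (a := (0 : ℝ))),
    Set.compl_Ioi, ← setLIntegral_congr Iio_ae_eq_Iic, hneg, h, ← add_mul,
    ENNReal.inv_two_add_inv_two, one_mul]

theorem incBeta_eq_toReal_lintegral {x a b : ℝ} (hx0 : 0 ≤ x) (hx1 : x ≤ 1) :
    incBeta x a b =
      (∫⁻ t in Set.Ioc 0 x, ENNReal.ofReal (t ^ (a - 1) * (1 - t) ^ (b - 1))).toReal := by
  rw [incBeta, intervalIntegral.integral_of_le hx0, integral_eq_lintegral_of_nonneg_ae]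
  · filter_upwards [ae_restrict_mem measurableSet_Ioc] with t ht
    exact mul_nonneg (Real.rpow_nonneg ht.1.le _)
      (Real.rpow_nonneg (sub_nonneg.2 (ht.2.trans hx1)) _)
  · exact Measurable.aestronglyMeasurable (by fun_prop)

theorem sphere_chord_cdf_lower (N : ℕ) (hN : 2 ≤ N)
    (p : EuclideanSpace ℝ (Fin N)) (hp : ‖p‖ = 1)
    (d : ℝ) (hd0 : 0 ≤ d) (hd : d ≤ Real.sqrt 2) :
    uniformOnSphere N {x | ‖x - p‖ ≤ d} =
      ENNReal.ofReal
        ((1 / 2) * regIncBeta (d ^ 2 - d ^ 4 / 4) (((N : ℝ) - 1) / 2) (1 / 2)) := by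
  obtain ⟨m, rfl⟩ := Nat.exists_eq_add_of_le' hN
  have hd2 : d ^ 2 ≤ 2 := (Real.le_sqrt hd0 (by norm_num)).1 hd
  have hc : 0 ≤ 1 - d ^ 2 / 2 := by linarith
  have hx : d ^ 2 - d ^ 4 / 4 = 1 - (1 - d ^ 2 / 2) ^ 2 := by ring
  have hx0 : 0 ≤ d ^ 2 - d ^ 4 / 4 := by nlinarith [sq_nonneg d]
  have hx1 : d ^ 2 - d ^ 4 / 4 ≤ 1 := by rw [hx]; linarith [sq_nonneg (1 - d ^ 2 / 2)]
  have ha : (((m + 2 : ℕ) : ℝ) - 1) / 2 = ((m + 1 : ℕ) : ℝ) / 2 := by push_cast; ring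
  rw [ha, regIncBeta, betaFn, incBeta_eq_toReal_lintegral hx0 hx1,
    incBeta_eq_toReal_lintegral zero_le_one le_rfl]
  set x := d ^ 2 - d ^ 4 / 4
  have hg : Measurable fun w : ℝ ↦ (1 + w ^ 2)⁻¹ := by fun_prop
  have hcone := volume_ball_inter_slope_mem hp
    (T := {w : ℝ | 0 < w ∧ (1 + w ^ 2)⁻¹ ≤ x})
    (S := {y | 0 < ‖y‖ ∧ ‖y‖ < 1 ∧ ‖y‖⁻¹ • y ∈ {x | ‖x - p‖ ≤ d}})
    (measurableSet_Ioi.inter (measurableSet_le hg measurable_const)) fun y q hq h hs ↦ by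
      have hy : 0 < ‖y‖ := by
        refine norm_pos_iff.2 ?_
        rintro rfl
        simp at hs
      simp only [Set.mem_ofPred_eq, hy, true_and, norm_inv_smul_sub_le_iff hp hy hd0, hx,
        mul_le_iff_slope hc hy.le hq h hs]
  have hball := volume_ball_inter_slope_mem hp (T := Set.univ) (S := ball 0 1)
    MeasurableSet.univ fun y q _ _ _ ↦ by simp
  have hmeas : MeasurableSet {x | ‖x - p‖ ≤ d} := by
    have h : Measurable fun x ↦ ‖x - p‖ := by fun_prop
    exact measurableSet_le h measurable_const
  rw [lintegral_slopes_univ (m + 1)] at hball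
  rw [lintegral_slopes_eq_lintegral_beta (m + 1) hx1] at hcone
  rw [uniformOnSphere_apply hmeas, hcone, hball]
  have hball0 : volume (ball (0 : EuclideanSpace ℝ (Fin (m + 2))) 1) ≠ 0 :=
    (measure_ball_pos _ _ one_pos).ne'
  have hballtop : volume (ball (0 : EuclideanSpace ℝ (Fin (m + 2))) 1) ≠ ⊤ :=
    measure_ball_lt_top.ne
  rw [hball] at hball0 hballtop
  have hmono : ∫⁻ t in Set.Ioc 0 x, ENNReal.ofReal
        (t ^ (((m + 1 : ℕ) : ℝ) / 2 - 1) * (1 - t) ^ ((1 / 2 : ℝ) - 1)) ≤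
      ∫⁻ t in Set.Ioc 0 1, ENNReal.ofReal
        (t ^ (((m + 1 : ℕ) : ℝ) / 2 - 1) * (1 - t) ^ ((1 / 2 : ℝ) - 1)) :=
    lintegral_mono_set (Set.Ioc_subset_Ioc_right hx1)
  generalize (∫⁻ t in Set.Ioc 0 x, ENNReal.ofReal
        (t ^ (((m + 1 : ℕ) : ℝ) / 2 - 1) * (1 - t) ^ ((1 / 2 : ℝ) - 1))) = L at *
  generalize (∫⁻ t in Set.Ioc 0 1, ENNReal.ofReal
        (t ^ (((m + 1 : ℕ) : ℝ) / 2 - 1) * (1 - t) ^ ((1 / 2 : ℝ) - 1))) = B at *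
  generalize (∫⁻ z in ball (0 : EuclideanSpace ℝ (Fin (m + 1))) 1, ENNReal.ofReal ‖z‖) = A at *
  have hA0 : A ≠ 0 := left_ne_zero_of_mul hball0
  have hB0 : B ≠ 0 := right_ne_zero_of_mul hball0
  have hAtop : A ≠ ⊤ := fun h ↦ hballtop (by rw [h, ENNReal.top_mul hB0])
  have hBtop : B ≠ ⊤ := fun h ↦ hballtop (by rw [h, ENNReal.mul_top hA0])
  have hLtop : L ≠ ⊤ := ne_top_of_le_ne_top hBtop hmono
  have hval : (1 / 2 : ℝ) * (L.toReal / B.toReal) = (2⁻¹ * (L / B)).toReal := by simp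
  rw [hval, ENNReal.ofReal_toReal
      (ENNReal.mul_ne_top (by simp) (ENNReal.div_ne_top hLtop hB0)),
    ENNReal.mul_inv (Or.inl hA0) (Or.inl hAtop), mul_mul_mul_comm,
    ENNReal.inv_mul_cancel hA0 hAtop, one_mul, ENNReal.div_eq_inv_mul, mul_left_comm]
end

section
/- The chord length D = ‖X - p‖, where X is uniform on the unit sphere S^{N-1} ⊂ ℝ^N (N ≥ 2) and p is fixed on the sphere, has probability density f(d) = d·(d² - d⁴/4)^{(N-3)/2} / B((N-1)/2, 1/2) on [0, 2], where B is the Beta function. -/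
open MeasureTheory Metric

open Set Real

theorem mul_rpow_self {x : ℝ} (hx : 0 < x) (y : ℝ) : x * x ^ y = x ^ (1 + y) := by
  rw [rpow_add hx, rpow_one]

theorem injOn_two_mul_sin_half : InjOn (fun θ : ℝ ↦ 2 * sin (θ / 2)) (Icc 0 π) := by
  intro x hx y hy h
  have := injOn_sin (x₁ := x / 2) ⟨by linarith [hx.1, pi_pos], by linarith [hx.2]⟩
    (x₂ := y / 2) ⟨by linarith [hy.1, pi_pos], by linarith [hy.2]⟩ (by simpa using h)
  linarith

theorem two_mul_sin_half_le_iff {t θ : ℝ} (ht : 0 ≤ t) (hθ : θ ∈ Ioo 0 π) :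
    2 * sin (θ / 2) ≤ t ↔ 1 - t ^ 2 / 2 ≤ cos θ := by
  have hs : 0 ≤ sin (θ / 2) :=
    sin_nonneg_of_nonneg_of_le_pi (by linarith [hθ.1]) (by linarith [hθ.1, hθ.2])
  have hc : cos θ = 1 - 2 * sin (θ / 2) ^ 2 := by
    have := cos_two_mul (θ / 2)
    rw [mul_div_cancel₀ _ two_ne_zero] at this
    nlinarith [sin_sq_add_cos_sq (θ / 2)]
  rw [hc, ← pow_le_pow_iff_left₀ (by positivity) ht two_ne_zero]
  constructor <;> intro h <;> nlinarith

/-- The angles in `(0, π)` subtending a chord of the unit circle of length at most `t`. -/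
def chordAngles (t : ℝ) : Set ℝ := {θ | θ ∈ Ioo 0 π ∧ 1 - t ^ 2 / 2 ≤ cos θ}

theorem measurableSet_chordAngles (t : ℝ) : MeasurableSet (chordAngles t) :=
  measurableSet_Ioo.inter (measurableSet_le measurable_const measurable_cos)

theorem chordAngles_two : chordAngles 2 = Ioo 0 π := by
  ext θ
  simp only [chordAngles, mem_ofPred_eq, and_iff_left_iff_imp]
  intro _
  linarith [neg_one_le_cos θ]

theorem image_chordAngles {t : ℝ} (ht0 : 0 ≤ t) (ht : t ≤ 2) :
    (fun θ : ℝ ↦ 2 * sin (θ / 2)) '' chordAngles t = Ioc 0 t \ {2} := by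
  ext d
  constructor
  · rintro ⟨θ, ⟨hθ, h⟩, rfl⟩
    refine ⟨⟨?_, (two_mul_sin_half_le_iff ht0 hθ).2 h⟩, ?_⟩
    · have := sin_pos_of_pos_of_lt_pi (x := θ / 2) (by linarith [hθ.1]) (by linarith [hθ.1, hθ.2])
      simpa using this
    · intro h2
      have := injOn_two_mul_sin_half (Ioo_subset_Icc_self hθ) (right_mem_Icc.2 pi_pos.le)
        (by simpa using h2)
      exact hθ.2.ne this
  · rintro ⟨⟨hd0, hdt⟩, hd2⟩
    have hd2' : d < 2 := lt_of_le_of_ne (hdt.trans ht) hd2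
    have hs : 2 * sin (2 * arcsin (d / 2) / 2) = d := by
      rw [mul_div_cancel_left₀ _ two_ne_zero, sin_arcsin (by linarith) (by linarith)]
      ring
    have hmem : 2 * arcsin (d / 2) ∈ Ioo 0 π := by
      refine ⟨by simpa using hd0, ?_⟩
      have : arcsin (d / 2) < π / 2 := arcsin_lt_pi_div_two.2 (by linarith)
      linarith
    refine ⟨2 * arcsin (d / 2), ⟨hmem, ?_⟩, hs⟩
    rw [← two_mul_sin_half_le_iff ht0 hmem, hs]
    exact hdt

theorem integral_chord (n : ℕ) {t : ℝ} (ht0 : 0 ≤ t) (ht : t ≤ 2) :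
    ∫ d in (0 : ℝ)..t, d * (d ^ 2 - d ^ 4 / 4) ^ (((n : ℝ) - 1) / 2) =
      ∫ θ in chordAngles t, sin θ ^ n := by
  have hae : (Ioc 0 t \ {2} : Set ℝ) =ᵐ[volume] Ioc 0 t := sdiff_null_ae_eq_self (by simp)
  rw [intervalIntegral.integral_of_le ht0, ← setIntegral_congr_set hae,
    ← image_chordAngles ht0 ht,
    integral_image_eq_integral_abs_deriv_smul (f' := fun θ ↦ cos (θ / 2))
      (measurableSet_chordAngles t) _
      (injOn_two_mul_sin_half.mono fun θ h ↦ Ioo_subset_Icc_self h.1)]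
  · refine setIntegral_congr_fun (measurableSet_chordAngles t) fun θ hθ ↦ ?_
    obtain ⟨h0, hπ⟩ := hθ.1
    have hs : 0 < sin θ := sin_pos_of_pos_of_lt_pi h0 hπ
    have hc : 0 < cos (θ / 2) := cos_pos_of_mem_Ioo ⟨by linarith, by linarith⟩
    have h2 : sin θ = 2 * sin (θ / 2) * cos (θ / 2) := by
      rw [← sin_two_mul, mul_div_cancel₀ _ two_ne_zero]
    have hsq : (2 * sin (θ / 2)) ^ 2 - (2 * sin (θ / 2)) ^ 4 / 4 = sin θ ^ (2 : ℝ) := by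
      rw [rpow_two, h2, mul_pow _ (cos _), cos_sq']
      ring
    simp only [smul_eq_mul]
    rw [abs_of_pos hc, hsq, ← rpow_mul hs.le, ← mul_assoc, mul_comm (cos _), ← h2,
      mul_div_cancel₀ _ two_ne_zero, mul_rpow_self hs, add_sub_cancel, rpow_natCast]
  · intro θ _
    have := (((hasDerivAt_id θ).div_const 2).sin.const_mul 2).hasDerivWithinAt (s := chordAngles t)
    exact this.congr_deriv (by simp only [id]; ring)

theorem image_cos_sq_Ioo : (fun φ : ℝ ↦ cos φ ^ 2) '' Ioo 0 (π / 2) = Ioo 0 1 := by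
  ext v
  constructor
  · rintro ⟨φ, ⟨h0, h1⟩, rfl⟩
    have hc : 0 < cos φ := cos_pos_of_mem_Ioo ⟨by linarith, h1⟩
    have hs : 0 < sin φ := sin_pos_of_pos_of_lt_pi h0 (by linarith)
    exact ⟨by positivity, by nlinarith [sin_sq_add_cos_sq φ]⟩
  · rintro ⟨h0, h1⟩
    have hv : √v < 1 := by rwa [sqrt_lt' one_pos, one_pow]
    refine ⟨arccos √v, ⟨arccos_pos.2 hv, arccos_lt_pi_div_two.2 (sqrt_pos.2 h0)⟩, ?_⟩
    simp only
    rw [cos_arccos (by linarith [sqrt_nonneg v]) hv.le, sq_sqrt h0.le]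

theorem betaFn_half (n : ℕ) :
    betaFn (((n : ℝ) + 1) / 2) (1 / 2) = ∫ θ in Ioo 0 π, sin θ ^ n := by
  have hinj : InjOn (fun φ : ℝ ↦ cos φ ^ 2) (Ioo 0 (π / 2)) := by
    intro x hx y hy h
    have hcx : 0 < cos x := cos_pos_of_mem_Ioo ⟨by linarith [hx.1, pi_pos], hx.2⟩
    have hcy : 0 < cos y := cos_pos_of_mem_Ioo ⟨by linarith [hy.1, pi_pos], hy.2⟩
    exact injOn_cos ⟨hx.1.le, by linarith [hx.2, pi_pos]⟩ ⟨hy.1.le, by linarith [hy.2, pi_pos]⟩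
      ((pow_left_inj₀ hcx.le hcy.le two_ne_zero).1 h)
  rw [betaFn, incBeta, intervalIntegral.integral_of_le zero_le_one, integral_Ioc_eq_integral_Ioo,
    ← image_cos_sq_Ioo,
    integral_image_eq_integral_abs_deriv_smul (f' := fun φ ↦ 2 * cos φ * (-sin φ))
      measurableSet_Ioo _ hinj]
  · have hcos := EulerSine.integral_cos_pow_eq n
    rw [intervalIntegral.integral_of_le (by positivity), integral_Ioc_eq_integral_Ioo,
      intervalIntegral.integral_of_le (by positivity), integral_Ioc_eq_integral_Ioo] at hcos
    have : ∫ θ in Ioo 0 π, sin θ ^ n = ∫ φ in Ioo 0 (π / 2), 2 * cos φ ^ n := by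
      rw [integral_const_mul, hcos]; ring
    rw [this]
    refine setIntegral_congr_fun measurableSet_Ioo fun φ ⟨h0, h1⟩ ↦ ?_
    have hc : 0 < cos φ := cos_pos_of_mem_Ioo ⟨by linarith, h1⟩
    have hs : 0 < sin φ := sin_pos_of_pos_of_lt_pi h0 (by linarith)
    have habs : |2 * cos φ * (-sin φ)| = 2 * cos φ * sin φ := by
      rw [mul_neg, abs_neg, abs_of_pos (by positivity)]
    have hsin : (1 - cos φ ^ 2) ^ ((1 / 2 : ℝ) - 1) = (sin φ)⁻¹ := by
      rw [← sin_sq, ← rpow_two, ← rpow_mul hs.le, ← rpow_neg_one]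
      norm_num
    have hcosp : cos φ * (cos φ ^ 2) ^ (((n : ℝ) + 1) / 2 - 1) = cos φ ^ n := by
      rw [← rpow_two, ← rpow_mul hc.le, mul_rpow_self hc, ← rpow_natCast]
      ring_nf
    simp only [smul_eq_mul]
    rw [habs, hsin, ← hcosp]
    field_simp
  · intro φ _
    have := ((hasDerivAt_cos φ).pow 2).hasDerivWithinAt (s := Ioo 0 (π / 2))
    exact this.congr_deriv (by simp)

open scoped Pointwise ENNReal

theorem lintegral_fun_norm_addHaar {F : Type*} [NormedAddCommGroup F] [NormedSpace ℝ F]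
    [MeasurableSpace F] [BorelSpace F] [FiniteDimensional ℝ F] [Nontrivial F]
    (μ : Measure F) [μ.IsAddHaarMeasure] {f : ℝ → ℝ≥0∞} (hf : Measurable f) :
    ∫⁻ x, f ‖x‖ ∂μ = μ.toSphere univ *
      ∫⁻ y in Ioi (0 : ℝ), ENNReal.ofReal (y ^ (Module.finrank ℝ F - 1)) * f y :=
  calc
    ∫⁻ x, f ‖x‖ ∂μ = ∫⁻ x : ({(0)}ᶜ : Set F), f ‖x.1‖ ∂(μ.comap (↑)) := by
      rw [lintegral_subtype_comap (measurableSet_singleton _).compl fun x ↦ f ‖x‖,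
        restrict_compl_singleton]
    _ = ∫⁻ x, 1 * f x.2 ∂μ.toSphere.prod (.volumeIoiPow (Module.finrank ℝ F - 1)) := by
      simpa using μ.measurePreserving_homeomorphUnitSphereProd.lintegral_comp_emb
        (Homeomorph.measurableEmbedding _) (f ∘ Subtype.val ∘ Prod.snd)
    _ = μ.toSphere univ * ∫⁻ x : Ioi (0 : ℝ), f x ∂.volumeIoiPow (Module.finrank ℝ F - 1) := by
      rw [lintegral_prod_mul (f := fun _ ↦ 1) (g := fun x : Ioi (0 : ℝ) ↦ f x) (by fun_prop)
        (by fun_prop), lintegral_one]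
    _ = _ := by
      rw [Measure.volumeIoiPow, lintegral_withDensity_eq_lintegral_mul _ (by fun_prop)
        (by fun_prop)]
      simp only [Pi.mul_apply]
      rw [lintegral_subtype_comap measurableSet_Ioi
        fun y : ℝ ↦ ENNReal.ofReal (y ^ (Module.finrank ℝ F - 1)) * f y]

/-- The points of the punctured open unit disc whose direction makes an angle of cosine at least `u`
with the first axis. -/
def planarSector (u : ℝ) : Set (ℝ × ℝ) :=
  {q | 0 < q.1 ^ 2 + q.2 ^ 2 ∧ q.1 ^ 2 + q.2 ^ 2 < 1 ∧ u * √(q.1 ^ 2 + q.2 ^ 2) ≤ q.1}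

theorem measurableSet_planarSector (u : ℝ) : MeasurableSet (planarSector u) := by
  have h1 : Measurable fun q : ℝ × ℝ ↦ q.1 ^ 2 + q.2 ^ 2 := by fun_prop
  exact (measurableSet_lt measurable_const h1).inter
    ((measurableSet_lt h1 measurable_const).inter
      (measurableSet_le (h1.sqrt.const_mul u) measurable_fst))

theorem lintegral_planarSector (n : ℕ) (t : ℝ) :
    ∫⁻ a : ℝ, ∫⁻ s in Ioi (0 : ℝ),
        ENNReal.ofReal (s ^ n) * (planarSector (1 - t ^ 2 / 2)).indicator 1 (a, s) =
      (∫⁻ r in Ioo (0 : ℝ) 1, ENNReal.ofReal (r ^ (n + 1))) *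
        ∫⁻ θ in chordAngles t, ENNReal.ofReal (sin θ ^ n) := by
  set P := planarSector (1 - t ^ 2 / 2) with hP
  have hPm : MeasurableSet P := measurableSet_planarSector _
  set f : ℝ × ℝ → ℝ≥0∞ := fun q ↦
    (Ioi (0 : ℝ)).indicator (fun s ↦ ENNReal.ofReal (s ^ n) * P.indicator 1 (q.1, s)) q.2 with hf
  have hfm : Measurable f := by
    have : f = (Prod.snd ⁻¹' Ioi (0 : ℝ)).indicator
        (fun q ↦ ENNReal.ofReal (q.2 ^ n) * P.indicator 1 q) := by
      ext q
      simp [hf, indicator]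
    rw [this]
    refine Measurable.indicator ?_ (measurable_snd measurableSet_Ioi)
    exact Measurable.mul (by fun_prop) (measurable_one.indicator hPm)
  calc
    _ = ∫⁻ q : ℝ × ℝ, f q := by
      rw [Measure.volume_eq_prod, lintegral_prod _ hfm.aemeasurable]
      simp only [hf, lintegral_indicator measurableSet_Ioi]
    _ = ∫⁻ p : ℝ × ℝ, (Ioo (0 : ℝ) 1).indicator (fun r ↦ ENNReal.ofReal (r ^ (n + 1))) p.1 *
          (chordAngles t).indicator (fun θ ↦ ENNReal.ofReal (sin θ ^ n)) p.2 := by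
      rw [← lintegral_comp_polarCoord_symm, ← lintegral_indicator polarCoord.open_target.measurableSet]
      congr 1
      ext ⟨r, θ⟩
      by_cases hr : 0 < r
      swap
      · simp [polarCoord_target, hr, indicator]
      by_cases hθ : θ ∈ Ioo 0 π
      swap
      · have h1 : θ ∉ chordAngles t := fun h ↦ hθ h.1
        rw [indicator_of_notMem h1, mul_zero, indicator_apply_eq_zero]
        rintro ⟨-, h2, h3⟩
        have hs : sin θ ≤ 0 := by
          apply sin_nonpos_of_nonpos_of_neg_pi_le _ h2.le
          by_contra! h4
          exact hθ ⟨h4, h3⟩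
        have : r * sin θ ∉ Ioi 0 := by
          simpa using mul_nonpos_of_nonneg_of_nonpos hr.le hs
        simp [hf, indicator_of_notMem this, polarCoord_symm_apply]
      have hs : 0 < sin θ := sin_pos_of_pos_of_lt_pi hθ.1 hθ.2
      have hmem : ((r, θ) : ℝ × ℝ) ∈ polarCoord.target := by
        simp only [polarCoord_target, mem_prod, mem_Ioi, mem_Ioo]
        exact ⟨hr, by linarith [hθ.1, pi_pos], hθ.2⟩
      have hsq : (r * cos θ) ^ 2 + (r * sin θ) ^ 2 = r ^ 2 := by
        linear_combination r ^ 2 * sin_sq_add_cos_sq θ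
      have hiff : (r * cos θ, r * sin θ) ∈ P ↔ r ∈ Ioo 0 1 ∧ θ ∈ chordAngles t := by
        simp only [hP, planarSector, chordAngles, mem_ofPred_eq, hsq, sqrt_sq hr.le, hθ, true_and]
        simp only [mem_Ioo, hr, true_and, sq_lt_one_iff₀ hr.le, pow_pos hr 2, mul_comm _ r, mul_le_mul_iff_right₀ hr]
      rw [indicator_of_mem hmem]
      have hmem' : r * sin θ ∈ Ioi 0 := mul_pos hr hs
      simp only [hf, polarCoord_symm_apply, indicator_of_mem hmem', smul_eq_mul]
      by_cases h1 : r ∈ Ioo 0 1 <;> by_cases h2 : θ ∈ chordAngles t <;>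
        simp only [indicator, hiff, h1, h2, true_and, and_true, and_self, if_true, if_false,
          mul_zero, zero_mul, Pi.one_apply, mul_one]
      rw [← ENNReal.ofReal_mul hr.le, ← ENNReal.ofReal_mul (by positivity)]
      ring_nf
    _ = _ := by
      rw [Measure.volume_eq_prod, lintegral_prod_mul, lintegral_indicator measurableSet_Ioo,
        lintegral_indicator (measurableSet_chordAngles t)]
      · exact (Measurable.indicator (by fun_prop) measurableSet_Ioo).aemeasurable
      · exact (Measurable.indicator (by fun_prop) (measurableSet_chordAngles t)).aemeasurable

/-- The part of the open unit ball lying over the spherical cap of chord radius `t` around `p`. -/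
def sphericalSector {E : Type*} [NormedAddCommGroup E] [InnerProductSpace ℝ E] (p : E) (t : ℝ) :
    Set E :=
  {x | 0 < ‖x‖ ∧ ‖x‖ < 1 ∧ (1 - t ^ 2 / 2) * ‖x‖ ≤ inner ℝ p x}

theorem measurableSet_sphericalSector {E : Type*} [NormedAddCommGroup E] [InnerProductSpace ℝ E]
    [MeasurableSpace E] [BorelSpace E] (p : E) (t : ℝ) :
    MeasurableSet (sphericalSector p t) := by
  have h : IsClosed {x : E | (1 - t ^ 2 / 2) * ‖x‖ ≤ inner ℝ p x} :=
    isClosed_le (by fun_prop) (by fun_prop)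
  exact (isOpen_lt continuous_const continuous_norm).measurableSet.inter
    ((isOpen_lt continuous_norm continuous_const).measurableSet.inter h.measurableSet)

theorem exists_measure_sphericalSector {E : Type*} [NormedAddCommGroup E] [InnerProductSpace ℝ E]
    [MeasurableSpace E] [BorelSpace E] [FiniteDimensional ℝ E] {n : ℕ}
    (hE : Module.finrank ℝ E = n + 2) (μ : Measure E) [μ.IsAddHaarMeasure] {p : E} (hp : ‖p‖ = 1) :
    ∃ C : ℝ≥0∞, ∀ t : ℝ,
      μ (sphericalSector p t) = C * ∫⁻ θ in chordAngles t, ENNReal.ofReal (sin θ ^ n) := by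
  have hp0 : p ≠ 0 := by
    rintro rfl
    simp at hp
  set F : Submodule ℝ E := (ℝ ∙ p)ᗮ
  have : Fact (Module.finrank ℝ E = (n + 1) + 1) := ⟨hE⟩
  have hF : Module.finrank ℝ F = n + 1 := Submodule.finrank_orthogonal_span_singleton hp0
  have : Nontrivial F := Module.nontrivial_of_finrank_pos (R := ℝ) (by omega)
  set L : ℝ × F →ₗ[ℝ] E := (LinearMap.toSpanSingleton ℝ E p).coprod F.subtype with hL
  have hLapply (q : ℝ × F) : L q = q.1 • p + q.2 := by simp [hL]
  have horth (y : F) : inner ℝ p (y : E) = 0 :=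
    Submodule.mem_orthogonal_singleton_iff_inner_right.1 y.2
  have hinner (q : ℝ × F) : inner ℝ p (L q) = q.1 := by
    rw [hLapply, inner_add_right, inner_smul_right, horth, real_inner_self_eq_norm_sq, hp]
    simp
  have hnorm (q : ℝ × F) : ‖L q‖ = √(q.1 ^ 2 + ‖q.2‖ ^ 2) := by
    rw [eq_comm, sqrt_eq_iff_eq_sq (by positivity) (norm_nonneg _), hLapply, norm_add_sq_real,
      inner_smul_left, horth, norm_smul, hp]
    simp
  have hinj : Function.Injective L := by
    refine (injective_iff_map_eq_zero L).2 fun q hq ↦ ?_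
    have h1 : q.1 = 0 := by rw [← hinner, hq, inner_zero_right]
    have h2 : (q.2 : E) = 0 := by simpa [hLapply, h1] using hq
    exact Prod.ext h1 (Subtype.ext h2)
  have hdim : Module.finrank ℝ (ℝ × F) = Module.finrank ℝ E := by
    rw [Module.finrank_prod, hF, hE, Module.finrank_self]
    omega
  set Φ : (ℝ × F) ≃L[ℝ] E := (L.linearEquivOfInjective hinj hdim).toContinuousLinearEquiv
  have hΦ (q : ℝ × F) : Φ q = L q := rfl
  set ν : Measure (ℝ × F) := (volume : Measure ℝ).prod volume
  have : (ν.map Φ).IsAddHaarMeasure := Φ.isAddHaarMeasure_map ν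
  set c := μ.addHaarScalarFactor (ν.map Φ)
  have hμ : μ = c • ν.map Φ := Measure.isAddLeftInvariant_eq_smul _ _
  refine ⟨c * ((volume : Measure F).toSphere univ *
    ∫⁻ r in Ioo (0 : ℝ) 1, ENNReal.ofReal (r ^ (n + 1))), fun t ↦ ?_⟩
  set P := planarSector (1 - t ^ 2 / 2) with hP
  have hPm : MeasurableSet P := measurableSet_planarSector _
  have hpre : Φ ⁻¹' sphericalSector p t = (fun q : ℝ × F ↦ (q.1, ‖q.2‖)) ⁻¹' P := by
    ext q
    simp only [mem_preimage, sphericalSector, mem_ofPred_eq, hΦ, hinner, hnorm, hP, planarSector,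
      sqrt_pos, sqrt_lt' one_pos, one_pow]
  have hind : Measurable (P.indicator (1 : ℝ × ℝ → ℝ≥0∞)) := measurable_one.indicator hPm
  have hmeas : Measurable fun q : ℝ × F ↦ (q.1, ‖q.2‖) := by fun_prop
  have hν : ν (Φ ⁻¹' sphericalSector p t) =
      ∫⁻ a : ℝ, ∫⁻ y : F, P.indicator 1 (a, ‖y‖) := by
    rw [hpre, ← lintegral_indicator_one (hmeas hPm),
      lintegral_prod _ (measurable_one.indicator (hmeas hPm)).aemeasurable]
    rfl
  have hslice (a : ℝ) : ∫⁻ y : F, P.indicator 1 (a, ‖y‖) = (volume : Measure F).toSphere univ *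
      ∫⁻ s in Ioi (0 : ℝ), ENNReal.ofReal (s ^ n) * P.indicator 1 (a, s) := by
    rw [lintegral_fun_norm_addHaar volume (f := fun s ↦ P.indicator 1 (a, s))
      (hind.comp (by fun_prop)), hF, Nat.add_sub_cancel]
  rw [hμ, Measure.smul_apply, Measure.map_apply Φ.continuous.measurable
    (measurableSet_sphericalSector p t), hν]
  simp only [hslice]
  rw [lintegral_const_mul' _ _ (measure_ne_top _ _), lintegral_planarSector, ENNReal.smul_def,
    smul_eq_mul, mul_assoc, mul_assoc]

theorem toSphere_chord {E : Type*} [NormedAddCommGroup E] [InnerProductSpace ℝ E]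
    [MeasurableSpace E] [BorelSpace E] (μ : Measure E) {p : E} (hp : ‖p‖ = 1) {t : ℝ}
    (ht : 0 ≤ t) :
    μ.toSphere {x : sphere (0 : E) 1 | ‖(x : E) - p‖ ≤ t} =
      Module.finrank ℝ E * μ (sphericalSector p t) := by
  have key (x : E) (hx : ‖x‖ = 1) : ‖x - p‖ ≤ t ↔ 1 - t ^ 2 / 2 ≤ inner ℝ p x := by
    rw [← pow_le_pow_iff_left₀ (norm_nonneg _) ht two_ne_zero, norm_sub_sq_real, hx, hp,
      real_inner_comm]
    constructor <;> intro h <;> linarith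
  have hm : MeasurableSet {x : sphere (0 : E) 1 | ‖(x : E) - p‖ ≤ t} :=
    (isClosed_le (by fun_prop) continuous_const).measurableSet
  rw [μ.toSphere_apply' hm]
  congr 2
  ext x
  simp only [mem_smul, mem_image, mem_ofPred_eq, sphericalSector]
  constructor
  · rintro ⟨r, ⟨hr0, hr1⟩, _, ⟨y, hy, rfl⟩, rfl⟩
    have hy1 : ‖(y : E)‖ = 1 := by simp
    rw [key _ hy1] at hy
    rw [norm_smul, hy1, mul_one, norm_eq_abs, abs_of_pos hr0, inner_smul_right, mul_comm]
    exact ⟨hr0, hr1, by gcongr⟩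
  · rintro ⟨h0, h1, h⟩
    have hx1 : ‖‖x‖⁻¹ • x‖ = 1 := by
      rw [norm_smul, norm_inv, norm_norm, inv_mul_cancel₀ h0.ne']
    refine ⟨‖x‖, ⟨h0, h1⟩, ‖x‖⁻¹ • x, ⟨⟨‖x‖⁻¹ • x, by simpa using hx1⟩, ?_, rfl⟩, ?_⟩
    · rw [key _ hx1, inner_smul_right, ← div_eq_inv_mul, le_div_iff₀ h0]
      exact h
    · rw [smul_smul, mul_inv_cancel₀ h0.ne', one_smul]

theorem lintegral_chordAngles (n : ℕ) (t : ℝ) :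
    ∫⁻ θ in chordAngles t, ENNReal.ofReal (sin θ ^ n) =
      ENNReal.ofReal (∫ θ in chordAngles t, sin θ ^ n) := by
  refine (ofReal_integral_eq_lintegral_ofReal ?_ ?_).symm
  · exact ((by fun_prop : Continuous fun θ : ℝ ↦ sin θ ^ n).integrableOn_Icc (a := 0)
      (b := π)).mono_set fun θ h ↦ Ioo_subset_Icc_self h.1
  · filter_upwards [ae_restrict_mem (measurableSet_chordAngles t)] with θ h
    exact pow_nonneg (sin_pos_of_pos_of_lt_pi h.1.1 h.1.2).le n

theorem sphere_chord_pdf (N : ℕ) (hN : 2 ≤ N)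
    (p : EuclideanSpace ℝ (Fin N)) (hp : ‖p‖ = 1)
    (t : ℝ) (ht0 : 0 ≤ t) (ht : t ≤ 2) :
    uniformOnSphere N {x | ‖x - p‖ ≤ t} =
      ENNReal.ofReal
        (∫ d in (0:ℝ)..t,
          d * (d ^ 2 - d ^ 4 / 4) ^ (((N : ℝ) - 3) / 2) /
            betaFn (((N : ℝ) - 1) / 2) (1 / 2)) := by
  obtain ⟨n, rfl⟩ := Nat.exists_eq_add_of_le' hN
  set σ := (volume : Measure (EuclideanSpace ℝ (Fin (n + 2)))).toSphere with hσ
  obtain ⟨C, hC⟩ := exists_measure_sphericalSector (n := n) (by simp)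
    (volume : Measure (EuclideanSpace ℝ (Fin (n + 2)))) hp
  set D : ℝ≥0∞ := Module.finrank ℝ (EuclideanSpace ℝ (Fin (n + 2))) * C with hD
  have hcap {s : ℝ} (hs : 0 ≤ s) :
      σ {x | ‖(x : EuclideanSpace ℝ (Fin (n + 2))) - p‖ ≤ s} =
        D * ENNReal.ofReal (∫ θ in chordAngles s, sin θ ^ n) := by
    rw [hσ, toSphere_chord _ hp hs, hC, lintegral_chordAngles, hD, mul_assoc]
  set B : ℝ := ∫ θ in Ioo 0 π, sin θ ^ n with hB
  have huniv : σ univ = D * ENNReal.ofReal B := by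
    rw [hB, ← chordAngles_two, ← hcap zero_le_two]
    congr 1
    refine (eq_univ_of_forall fun x ↦ ?_).symm
    have hx : ‖(x : EuclideanSpace ℝ (Fin (n + 2)))‖ = 1 := by simp
    have := norm_sub_le (x : EuclideanSpace ℝ (Fin (n + 2))) p
    rw [hx, hp] at this
    exact this.trans_eq one_add_one_eq_two
  have huniv0 : D * ENNReal.ofReal B ≠ 0 := by
    rw [← huniv, Measure.measure_univ_ne_zero]
    exact Measure.toSphere_ne_zero _
  have hD0 : D ≠ 0 := left_ne_zero_of_mul huniv0
  have hB0 : 0 < B := ENNReal.ofReal_pos.1 (pos_iff_ne_zero.2 (right_ne_zero_of_mul huniv0))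
  have hDtop : D ≠ ∞ := by
    intro h
    have : σ univ ≠ ∞ := measure_ne_top _ _
    rw [huniv, h, ENNReal.top_mul (right_ne_zero_of_mul huniv0)] at this
    exact this rfl
  have hbeta : betaFn ((((n + 2 : ℕ) : ℝ) - 1) / 2) (1 / 2) = B := by
    rw [hB, ← betaFn_half]
    push_cast
    ring_nf
  have hexp : (((n + 2 : ℕ) : ℝ) - 3) / 2 = ((n : ℝ) - 1) / 2 := by
    push_cast
    ring
  have hset : MeasurableSet {x : EuclideanSpace ℝ (Fin (n + 2)) | ‖x - p‖ ≤ t} :=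
    (isClosed_le (by fun_prop) continuous_const).measurableSet
  rw [uniformOnSphere, Measure.map_apply measurable_subtype_coe hset, Measure.smul_apply, ← hσ,
    preimage_ofPred_eq, hcap ht0, huniv, hbeta, hexp, intervalIntegral.integral_div,
    integral_chord n ht0 ht, ENNReal.ofReal_div_of_pos hB0, smul_eq_mul, mul_comm,
    ← div_eq_mul_inv, ENNReal.mul_div_mul_left _ _ hD0 hDtop]
end

section
/- For the chord length D of the unit sphere S^{N-1} (N ≥ 2), the k-th moment is E[D^k] = 2^{k+N-2} · B((k+N-1)/2, (N-1)/2) / B((N-1)/2, 1/2). -/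
open MeasureTheory Metric

namespace SphereChord

open Real Set

section Polar

variable {E : Type*} [NormedAddCommGroup E] [NormedSpace ℝ E] [MeasurableSpace E] [BorelSpace E]
  [FiniteDimensional ℝ E] [Nontrivial E] (μ : Measure E) [μ.IsAddHaarMeasure]

/-- Integration in polar coordinates of a product of a radial and an angular function. -/
lemma integral_norm_mul_direction (w : ℝ → ℝ) (g : E → ℝ) :
    ∫ x, w ‖x‖ * g (‖x‖⁻¹ • x) ∂μ =
      (∫ u : sphere (0 : E) 1, g u ∂μ.toSphere) *
        ∫ r : Ioi (0 : ℝ), w r ∂(Measure.volumeIoiPow (Module.finrank ℝ E - 1)) := by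
  rw [← integral_prod_mul (fun u : sphere (0 : E) 1 => g u) (fun r : Ioi (0 : ℝ) => w r),
    ← μ.measurePreserving_homeomorphUnitSphereProd.integral_comp
      (Homeomorph.measurableEmbedding _)]
  simp only [homeomorphUnitSphereProd_apply_snd_coe, homeomorphUnitSphereProd_apply_fst_coe]
  rw [integral_subtype_comap (measurableSet_singleton _).compl
    fun x : E => g (‖x‖⁻¹ • x) * w ‖x‖, restrict_compl_singleton]
  simp only [mul_comm]

end Polar

/-- Splitting off the coordinate in the direction of a unit vector. -/
lemma integral_inner_norm (n : ℕ) (p : EuclideanSpace ℝ (Fin (n + 1))) (hp : ‖p‖ = 1)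
    (F : ℝ → ℝ → ℝ) :
    ∫ x, F (inner ℝ p x) ‖x‖ =
      ∫ z : ℝ × EuclideanSpace ℝ (Fin n), F z.1 √(z.1 ^ 2 + ‖z.2‖ ^ 2) := by
  obtain ⟨b, hb⟩ := Orthonormal.exists_orthonormalBasis_extension_of_card_eq (𝕜 := ℝ)
    (E := EuclideanSpace ℝ (Fin (n + 1))) (ι := Fin (n + 1)) (by simp)
    (v := fun _ => p) (s := {0}) (by
      refine ⟨fun _ => hp, fun i j hij => (hij (Subsingleton.elim i j)).elim⟩)
  have hb0 : b 0 = p := hb 0 rfl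
  have h1 := b.measurePreserving_repr
  have h2 := EuclideanSpace.volume_preserving_symm_measurableEquiv_toLp (Fin (n + 1))
  have h3 := volume_preserving_piFinSuccAbove (fun _ : Fin (n + 1) => ℝ) 0
  have h4 : MeasurePreserving (MeasurableEquiv.prodCongr (MeasurableEquiv.refl ℝ)
      (MeasurableEquiv.toLp 2 (Fin n → ℝ))) volume volume :=
    (MeasurePreserving.id volume).prod (PiLp.volume_preserving_toLp (Fin n))
  have h := ((h4.comp h3).comp h2).comp h1
  have hemb := (((MeasurableEquiv.prodCongr (MeasurableEquiv.refl ℝ)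
      (MeasurableEquiv.toLp 2 (Fin n → ℝ))).measurableEmbedding.comp
    (MeasurableEquiv.piFinSuccAbove (fun _ : Fin (n + 1) => ℝ) 0).measurableEmbedding).comp
    (MeasurableEquiv.toLp 2 (Fin (n + 1) → ℝ)).symm.measurableEmbedding).comp b.measurableEquiv.measurableEmbedding
  rw [← h.integral_comp hemb]
  refine integral_congr_ae (.of_forall fun x => ?_)
  have hx : ‖x‖ = √((b.repr x 0) ^ 2 + ∑ i : Fin n, (b.repr x i.succ) ^ 2) := by
    rw [← b.repr.norm_map, EuclideanSpace.norm_eq, Fin.sum_univ_succ]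
    simp
  have hi : inner ℝ p x = b.repr x 0 := by rw [b.repr_apply_apply, hb0]
  change _ = F (b.repr x 0) √((b.repr x 0) ^ 2 +
    ‖(WithLp.toLp 2 fun i : Fin n => b.repr x i.succ : EuclideanSpace ℝ (Fin n))‖ ^ 2)
  simp only [hx, hi, EuclideanSpace.norm_sq_eq, norm_eq_abs, sq_abs]

variable {V : Type*} [NormedAddCommGroup V] [InnerProductSpace ℝ V] [FiniteDimensional ℝ V]
  [MeasurableSpace V] [BorelSpace V]

lemma integral_exp_neg_norm_sq_pos : 0 < ∫ v : V, exp (-‖v‖ ^ 2) := by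
  have h := GaussianFourier.integral_rexp_neg_mul_sq_norm (V := V) one_pos
  simp only [neg_mul, one_mul] at h
  rw [h]
  positivity

lemma integrable_exp_neg_norm_sq : Integrable fun v : V => exp (-‖v‖ ^ 2) :=
  .of_integral_ne_zero integral_exp_neg_norm_sq_pos.ne'

lemma integrable_abs_pow_mul_exp (m : ℕ) :
    Integrable fun r : ℝ => |r| ^ m * exp (-r ^ 2) := by
  have h := (integrable_rpow_mul_exp_neg_mul_sq one_pos
    (s := m) (by linarith [m.cast_nonneg (α := ℝ)])).norm
  refine h.congr (.of_forall fun x => ?_)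
  simp

variable {h : ℝ → ℝ} {C : ℝ}

lemma div_sqrt_mem_Icc (s r : ℝ) : s / √(s ^ 2 + r ^ 2) ∈ Icc (-1 : ℝ) 1 := by
  rw [mem_Icc, ← abs_le, abs_div, abs_of_nonneg (sqrt_nonneg _)]
  refine div_le_one_of_le₀ ?_ (sqrt_nonneg _)
  exact abs_le_sqrt (by nlinarith)

lemma integrable_mul_prod_of_bound {α β : Type*} [MeasurableSpace α] [MeasurableSpace β]
    {μ : Measure α} {ν : Measure β} {f : α → ℝ} {g : β → ℝ} {k : α × β → ℝ}
    (hf : Integrable f μ) (hg : Integrable g ν) (hk : Measurable k) (hC : ∀ z, |k z| ≤ C) :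
    Integrable (fun z => k z * (f z.1 * g z.2)) (μ.prod ν) :=
  (hf.mul_prod hg).bdd_mul hk.aestronglyMeasurable (.of_forall hC)

/-- Integration in polar coordinates in the second factor. -/
lemma integral_prod_eq_integral_real_prod (m : ℕ) (hc : Continuous h)
    (hC : ∀ u ∈ Icc (-1 : ℝ) 1, |h u| ≤ C) (hV : Module.finrank ℝ V = m + 1) :
    ∫ z : ℝ × V, h (z.1 / √(z.1 ^ 2 + ‖z.2‖ ^ 2)) * (exp (-z.1 ^ 2) * exp (-‖z.2‖ ^ 2)) =
      ((m + 1) * volume.real (ball (0 : V) 1) / 2) *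
        ∫ z : ℝ × ℝ, h (z.1 / √(z.1 ^ 2 + z.2 ^ 2)) *
          (exp (-z.1 ^ 2) * (|z.2| ^ m * exp (-z.2 ^ 2))) := by
  have : Nontrivial V := Module.nontrivial_of_finrank_pos (R := ℝ) (by omega)
  have hG : Integrable fun s : ℝ => exp (-s ^ 2) := by
    simpa using integrable_exp_neg_mul_sq one_pos
  rw [Measure.volume_eq_prod, Measure.volume_eq_prod, integral_prod, integral_prod,
    ← integral_const_mul]
  · congr 1 with s
    have h1 := integral_fun_norm_addHaar (volume : Measure V)
      (fun r => h (s / √(s ^ 2 + r ^ 2)) * (exp (-s ^ 2) * exp (-r ^ 2)))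
    have h2 := integral_comp_abs (f := fun r : ℝ => h (s / √(s ^ 2 + r ^ 2)) *
          (exp (-s ^ 2) * (r ^ m * exp (-r ^ 2))))
    simp only [sq_abs] at h2
    rw [h1, h2, hV, nsmul_eq_mul, smul_eq_mul]
    have h3 : ∀ r : ℝ, r ^ (m + 1 - 1) • (h (s / √(s ^ 2 + r ^ 2)) * (exp (-s ^ 2) * exp (-r ^ 2)))
      = h (s / √(s ^ 2 + r ^ 2)) * (exp (-s ^ 2) * (r ^ m * exp (-r ^ 2))) := by
      intro r
      rw [Nat.add_sub_cancel, smul_eq_mul]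
      ring
    simp only [h3]
    push_cast
    ring
  · exact integrable_mul_prod_of_bound hG (integrable_abs_pow_mul_exp m)
      (hc.measurable.comp (by fun_prop)) (fun z => hC _ (div_sqrt_mem_Icc _ _))
  · exact integrable_mul_prod_of_bound hG integrable_exp_neg_norm_sq
      (hc.measurable.comp (by fun_prop)) (fun z => hC _ (div_sqrt_mem_Icc _ _))

lemma integral_real_prod_eq (m : ℕ) (h : ℝ → ℝ) :
    ∫ z : ℝ × ℝ, h (z.1 / √(z.1 ^ 2 + z.2 ^ 2)) *
          (exp (-z.1 ^ 2) * (|z.2| ^ m * exp (-z.2 ^ 2))) =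
      (∫ r in Ioi (0 : ℝ), r ^ (m + 1) * exp (-r ^ 2)) *
        (2 * ∫ θ in Ioo 0 π, sin θ ^ m * h (cos θ)) := by
  have hθ : ∫ θ in Ioo (-π) π, |sin θ| ^ m * h (cos θ) =
      2 * ∫ θ in Ioo 0 π, sin θ ^ m * h (cos θ) := by
    have h1 := integral_comp_abs (f := (Iio π).indicator fun θ => |sin θ| ^ m * h (cos θ))
    rw [setIntegral_indicator measurableSet_Iio, Ioi_inter_Iio] at h1
    rw [← integral_indicator measurableSet_Ioo]
    convert h1 using 1
    · congr 1 with θ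
      by_cases hθ : |θ| < π
      · rw [indicator_of_mem (by simpa using abs_lt.1 hθ), indicator_of_mem (by simpa using hθ),
          cos_abs]
        rcases abs_choice θ with h | h <;> simp [h]
      · rw [indicator_of_notMem (by simpa [abs_lt] using hθ),
          indicator_of_notMem (by simpa using hθ)]
    · congr 1
      refine setIntegral_congr_fun measurableSet_Ioo fun θ hθ => ?_
      simp only [abs_of_pos (sin_pos_of_mem_Ioo hθ)]
  rw [← hθ, ← setIntegral_prod_mul, ← Measure.volume_eq_prod, ← integral_comp_polarCoord_symm,
    polarCoord_target]
  refine setIntegral_congr_fun (measurableSet_Ioi.prod measurableSet_Ioo) ?_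
  rintro ⟨r, θ⟩ ⟨hr, -⟩
  have hr : 0 < r := hr
  have hs : (r * cos θ) ^ 2 + (r * sin θ) ^ 2 = r ^ 2 := by
    linear_combination r ^ 2 * sin_sq_add_cos_sq θ
  simp only [polarCoord_symm_apply, hs, sqrt_sq hr.le, smul_eq_mul, mul_div_cancel_left₀ _ hr.ne',
    abs_mul, abs_of_pos hr, mul_pow r |sin θ|]
  have he : exp (-r ^ 2) = exp (-(r * cos θ) ^ 2) * exp (-(r * sin θ) ^ 2) := by
    rw [← exp_add, ← hs]
    congr 1
    ring
  rw [he]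
  ring

/-- The law of the latitude on the sphere, up to normalization. -/
lemma exists_integral_toSphere_mul (m : ℕ) (p : EuclideanSpace ℝ (Fin (m + 2))) (hp : ‖p‖ = 1) :
    ∃ K c : ℝ, K ≠ 0 ∧ ∀ h : ℝ → ℝ, Continuous h →
      (∫ u : sphere (0 : EuclideanSpace ℝ (Fin (m + 2))) 1, h (inner ℝ p u)
          ∂(volume : Measure (EuclideanSpace ℝ (Fin (m + 2)))).toSphere) * K =
        c * ∫ θ in Ioo 0 π, sin θ ^ m * h (cos θ) := by
  refine ⟨∫ r : Ioi (0 : ℝ), exp (-(r : ℝ) ^ 2) ∂(Measure.volumeIoiPow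
      (Module.finrank ℝ (EuclideanSpace ℝ (Fin (m + 2))) - 1)),
    ((m + 1) * volume.real (ball (0 : EuclideanSpace ℝ (Fin (m + 1))) 1) / 2) *
      ((∫ r in Ioi (0 : ℝ), r ^ (m + 1) * exp (-r ^ 2)) * 2), ?_, fun h hc => ?_⟩
  · have h1 := integral_norm_mul_direction
      (volume : Measure (EuclideanSpace ℝ (Fin (m + 2)))) (fun r => exp (-r ^ 2)) (fun _ => 1)
    simp only [mul_one] at h1
    exact right_ne_zero_of_mul (h1 ▸ integral_exp_neg_norm_sq_pos.ne')
  obtain ⟨C, hC⟩ := (isCompact_Icc (a := (-1 : ℝ)) (b := 1)).exists_bound_of_continuousOn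
    hc.continuousOn
  rw [← integral_norm_mul_direction volume (fun r => exp (-r ^ 2)) (fun x => h (inner ℝ p x))]
  simp only [inner_smul_right]
  rw [integral_inner_norm (m + 1) p hp fun s ρ => exp (-ρ ^ 2) * h (ρ⁻¹ * s)]
  have h1 := integral_prod_eq_integral_real_prod (V := EuclideanSpace ℝ (Fin (m + 1))) m hc hC
    (by simp)
  rw [integral_real_prod_eq] at h1
  rw [mul_assoc, mul_assoc, ← h1]
  congr 1 with z
  rw [sq_sqrt (by positivity), neg_add, exp_add, inv_mul_eq_div, mul_comm]

/-- The mean of a function of the latitude over the uniform distribution on the sphere. -/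
lemma integral_uniformOnSphere_inner (m : ℕ) (p : EuclideanSpace ℝ (Fin (m + 2))) (hp : ‖p‖ = 1)
    {h : ℝ → ℝ} (hc : Continuous h) :
    ∫ x, h (inner ℝ p x) ∂(uniformOnSphere (m + 2)) =
      (∫ θ in Ioo 0 π, sin θ ^ m * h (cos θ)) / ∫ θ in Ioo 0 π, sin θ ^ m := by
  obtain ⟨K, c, hK, H⟩ := exists_integral_toSphere_mul m p hp
  set σ := (volume : Measure (EuclideanSpace ℝ (Fin (m + 2)))).toSphere with hσ
  have hσ0 : σ.real univ ≠ 0 := by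
    rw [measureReal_ne_zero_iff, Measure.measure_univ_ne_zero]
    exact Measure.toSphere_ne_zero _
  have H1 := H (fun _ => 1) continuous_const
  have Hh := H h hc
  have hJ : 0 < ∫ θ in Ioo 0 π, sin θ ^ m := by
    rw [← integral_Ioc_eq_integral_Ioo, ← intervalIntegral.integral_of_le pi_pos.le]
    exact integral_sin_pow_pos m
  simp only [mul_one, integral_const, smul_eq_mul] at H1
  rw [uniformOnSphere, integral_map measurable_subtype_coe.aemeasurable
      (Continuous.aestronglyMeasurable (by fun_prop)),
    integral_smul_measure, ← hσ, ENNReal.toReal_inv, ← measureReal_def, smul_eq_mul,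
    eq_div_iff hJ.ne', inv_mul_eq_div, div_mul_eq_mul_div, div_eq_iff hσ0]
  apply mul_right_cancel₀ hK
  linear_combination (∫ θ in Ioo 0 π, sin θ ^ m) * Hh - (∫ θ in Ioo 0 π, sin θ ^ m * h (cos θ)) * H1

lemma betaFn_eq_beta {a b : ℝ} (ha : 0 < a) (hb : 0 < b) :
    betaFn a b = ProbabilityTheory.beta a b := by
  rw [ProbabilityTheory.beta_eq_betaIntegralReal a b ha hb, betaFn, incBeta, Complex.betaIntegral]
  have : ∫ t in (0 : ℝ)..1, (t : ℂ) ^ ((a : ℂ) - 1) * (1 - (t : ℂ)) ^ ((b : ℂ) - 1) =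
      ∫ t in (0 : ℝ)..1, ((t ^ (a - 1) * (1 - t) ^ (b - 1) : ℝ) : ℂ) := by
    refine intervalIntegral.integral_congr fun t ht => ?_
    rw [uIcc_of_le zero_le_one] at ht
    push_cast [Complex.ofReal_cpow ht.1, Complex.ofReal_cpow (sub_nonneg.2 ht.2)]
    rfl
  rw [this, intervalIntegral.integral_ofReal, Complex.ofReal_re]

/-- The duplication formula for the beta function. -/
lemma betaFn_half {a : ℝ} (ha : 0 < a) :
    betaFn a (1 / 2) = 2 ^ (2 * a - 1) * betaFn a a := by
  rw [betaFn_eq_beta ha one_half_pos, betaFn_eq_beta ha ha, ProbabilityTheory.beta,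
    ProbabilityTheory.beta, Real.Gamma_one_half_eq, ← two_mul]
  have h := Real.Gamma_mul_Gamma_add_half a
  have h1 := (Real.Gamma_pos_of_pos (show 0 < a + 1 / 2 by linarith)).ne'
  have h2 := (Real.Gamma_pos_of_pos (show 0 < 2 * a by linarith)).ne'
  have h3 : (2 : ℝ) ^ (2 * a - 1) * 2 ^ (1 - 2 * a) = 1 := by
    rw [← rpow_add two_pos]
    simp
  rw [div_eq_iff h1]
  symm
  calc _ = 2 ^ (2 * a - 1) * Real.Gamma a / Real.Gamma (2 * a) *
        (Real.Gamma a * Real.Gamma (a + 1 / 2)) := by ring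
    _ = 2 ^ (2 * a - 1) * 2 ^ (1 - 2 * a) * (Real.Gamma a * √π) *
        (Real.Gamma (2 * a) / Real.Gamma (2 * a)) := by
      rw [h]
      ring
    _ = _ := by rw [h3, div_self h2, one_mul, mul_one]

/-- The trigonometric form of the beta integral. -/
lemma integral_sin_pow_mul_chord_pow (m k : ℕ) :
    ∫ θ in Ioo 0 π, sin θ ^ m * √(2 - 2 * cos θ) ^ k =
      2 ^ (k + m) * betaFn (((k : ℝ) + m + 1) / 2) (((m : ℝ) + 1) / 2) := by
  have hd : ∀ θ ∈ Ioo 0 π, HasDerivWithinAt (fun θ => (1 - cos θ) / 2) (sin θ / 2) (Ioo 0 π) θ := by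
    intro θ _
    simpa using (((hasDerivAt_cos θ).const_sub 1).div_const 2).hasDerivWithinAt
  have hinj : InjOn (fun θ => (1 - cos θ) / 2) (Ioo 0 π) := by
    intro x hx y hy hxy
    refine injOn_cos (Ioo_subset_Icc_self hx) (Ioo_subset_Icc_self hy) ?_
    simp only at hxy
    linarith
  have himg : (fun θ => (1 - cos θ) / 2) '' Ioo 0 π = Ioo 0 1 := by
    ext t
    constructor
    · rintro ⟨θ, hθ, rfl⟩
      have h1 : 0 < sin θ := sin_pos_of_mem_Ioo hθ
      have h2 := sin_sq_add_cos_sq θ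
      constructor <;> simp only <;> nlinarith
    · rintro ⟨h0, h1⟩
      refine ⟨arccos (1 - 2 * t), ⟨arccos_pos.2 (by linarith), ?_⟩, ?_⟩
      · exact (arccos_le_pi _).lt_of_ne fun h => by linarith [arccos_eq_pi.1 h]
      · simp only [cos_arccos (show -1 ≤ 1 - 2 * t by linarith) (by linarith)]
        ring
  rw [betaFn, incBeta, intervalIntegral.integral_of_le zero_le_one, integral_Ioc_eq_integral_Ioo,
    ← himg, integral_image_eq_integral_abs_deriv_smul measurableSet_Ioo hd hinj,
    ← integral_const_mul]
  refine setIntegral_congr_fun measurableSet_Ioo fun θ hθ => ?_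
  obtain ⟨x, rfl⟩ : ∃ x, θ = 2 * x := ⟨θ / 2, by ring⟩
  have hs : 0 < sin x := sin_pos_of_mem_Ioo ⟨by linarith [hθ.1], by linarith [hθ.2, pi_pos]⟩
  have hcx : 0 < cos x := cos_pos_of_mem_Ioo ⟨by linarith [hθ.1, pi_pos], by linarith [hθ.2]⟩
  have e1 : (1 - cos (2 * x)) / 2 = sin x ^ 2 := by
    rw [cos_two_mul]
    linear_combination -sin_sq_add_cos_sq x
  have e2 : 1 - sin x ^ 2 = cos x ^ 2 := by linear_combination -sin_sq_add_cos_sq x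
  have e3 : √(2 - 2 * cos (2 * x)) = 2 * sin x := by
    rw [← sqrt_sq (show 0 ≤ 2 * sin x by positivity)]
    congr 1
    linear_combination 4 * e1
  have e4 (y : ℝ) (hy : 0 < y) (j : ℕ) : (y ^ 2) ^ (((j : ℝ) + 1) / 2 - 1) * y = y ^ j := by
    nth_rewrite 2 [← rpow_one y]
    rw [← rpow_natCast y 2, ← rpow_mul hy.le, ← rpow_add hy, ← rpow_natCast]
    congr 1
    push_cast
    ring
  have e5 := e4 _ hs (k + m)
  have e6 := e4 _ hcx m
  push_cast at e5
  simp only [e1, e2, e3, smul_eq_mul, sin_two_mul]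
  rw [abs_of_pos (by positivity)]
  calc _ = 2 ^ (k + m) * (sin x ^ (k + m) * cos x ^ m) := by ring
    _ = _ := by
      rw [← e5, ← e6]
      ring

end SphereChord

theorem sphere_chord_moment (N : ℕ) (hN : 2 ≤ N)
    (p : EuclideanSpace ℝ (Fin N)) (hp : ‖p‖ = 1) (k : ℕ) :
    ∫ x, ‖x - p‖ ^ k ∂(uniformOnSphere N) =
      2 ^ (k + N - 2) *
        betaFn (((k : ℝ) + (N : ℝ) - 1) / 2) (((N : ℝ) - 1) / 2) /
          betaFn (((N : ℝ) - 1) / 2) (1 / 2) := by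
  obtain ⟨m, rfl⟩ : ∃ m, N = m + 2 := ⟨N - 2, by omega⟩
  have hchord : ∫ x, ‖x - p‖ ^ k ∂(uniformOnSphere (m + 2)) =
      ∫ x, √(2 - 2 * inner ℝ p x) ^ k ∂(uniformOnSphere (m + 2)) := by
    rw [uniformOnSphere, integral_map measurable_subtype_coe.aemeasurable
        (by fun_prop), integral_map measurable_subtype_coe.aemeasurable
        (Continuous.aestronglyMeasurable (by fun_prop))]
    congr 1 with x
    have hx : ‖(x : EuclideanSpace ℝ (Fin (m + 2)))‖ = 1 := by simp
    have h2 : ‖(x : EuclideanSpace ℝ (Fin (m + 2))) - p‖ ^ 2 =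
        2 - 2 * inner ℝ p (x : EuclideanSpace ℝ (Fin (m + 2))) := by
      rw [norm_sub_sq_real, hx, hp, real_inner_comm]
      ring
    rw [← h2, Real.sqrt_sq (norm_nonneg _)]
  have h0 := SphereChord.integral_sin_pow_mul_chord_pow m 0
  simp only [pow_zero, mul_one, zero_add, Nat.cast_zero] at h0
  rw [hchord, SphereChord.integral_uniformOnSphere_inner m p hp
    (h := fun u => √(2 - 2 * u) ^ k) (by fun_prop),
    SphereChord.integral_sin_pow_mul_chord_pow, h0]
  have e1 : ((k : ℝ) + ((m + 2 : ℕ) : ℝ) - 1) / 2 = ((k : ℝ) + m + 1) / 2 := by push_cast; ring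
  have e2 : (((m + 2 : ℕ) : ℝ) - 1) / 2 = ((m : ℝ) + 1) / 2 := by push_cast; ring
  rw [e1, e2, SphereChord.betaFn_half (by positivity), ← add_assoc, Nat.add_sub_cancel,
    show 2 * (((m : ℝ) + 1) / 2) - 1 = m by ring, Real.rpow_natCast]
end

section
/- The mean chord length of the unit sphere S^{N-1} (N ≥ 2) is E[D] = 2^{N-1} · B(N/2, N/2) / B(N - 1/2, 1/2). -/
open MeasureTheory Metric

open scoped ENNReal Real RealInnerProductSpace

lemma lintegral_volumeIoiPow (n : ℕ) (f : ℝ → ℝ≥0∞) (hf : Measurable f) :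
    ∫⁻ r : Set.Ioi (0 : ℝ), f r ∂Measure.volumeIoiPow n =
      ∫⁻ r in Set.Ioi (0 : ℝ), ENNReal.ofReal (r ^ n) * f r := by
  rw [Measure.volumeIoiPow, lintegral_withDensity_eq_lintegral_mul _ (by fun_prop) (by fun_prop)]
  exact lintegral_subtype_comap measurableSet_Ioi fun r : ℝ ↦ ENNReal.ofReal (r ^ n) * f r

lemma lintegral_eq_lintegral_toSphere {E : Type*} [NormedAddCommGroup E] [NormedSpace ℝ E]
    [Nontrivial E] [FiniteDimensional ℝ E] [MeasurableSpace E] [BorelSpace E] (μ : Measure E)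
    [μ.IsAddHaarMeasure] (F : E → ℝ≥0∞) (hF : Measurable F) :
    ∫⁻ x, F x ∂μ = ∫⁻ ω : sphere (0 : E) 1, ∫⁻ r : Set.Ioi (0 : ℝ), F ((r : ℝ) • (ω : E))
      ∂Measure.volumeIoiPow (Module.finrank ℝ E - 1) ∂μ.toSphere := by
  rw [← lintegral_prod (fun q : sphere (0 : E) 1 × Set.Ioi (0 : ℝ) ↦ F ((q.2 : ℝ) • (q.1 : E)))
      (by fun_prop),
    ← μ.measurePreserving_homeomorphUnitSphereProd.lintegral_comp_emb
      (Homeomorph.measurableEmbedding _),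
    ← setLIntegral_univ, setLIntegral_congr
      (Filter.eventuallyEq_univ.2 (compl_mem_ae_iff.2 (measure_singleton (0 : E)))).symm,
    ← lintegral_subtype_comap (measurableSet_singleton (0 : E)).compl]
  refine lintegral_congr fun x ↦ ?_
  congr 1
  exact (congrArg Subtype.val ((homeomorphUnitSphereProd E).symm_apply_apply x)).symm

lemma lintegral_comp_norm {E : Type*} [NormedAddCommGroup E] [NormedSpace ℝ E]
    [Nontrivial E] [FiniteDimensional ℝ E] [MeasurableSpace E] [BorelSpace E] (μ : Measure E)
    [μ.IsAddHaarMeasure] (f : ℝ → ℝ≥0∞) (hf : Measurable f) :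
    ∫⁻ x, f ‖x‖ ∂μ = μ.toSphere Set.univ *
      ∫⁻ r in Set.Ioi (0 : ℝ), ENNReal.ofReal (r ^ (Module.finrank ℝ E - 1)) * f r := by
  rw [lintegral_eq_lintegral_toSphere μ _ (by fun_prop), ← lintegral_volumeIoiPow _ f hf, mul_comm,
    ← lintegral_const]
  refine lintegral_congr fun ω ↦ lintegral_congr fun r ↦ ?_
  have hr : (0 : ℝ) < r := r.2
  simp [norm_smul, abs_of_pos hr]

lemma lintegral_eq_lintegral_orthogonal {E : Type*} [NormedAddCommGroup E] [InnerProductSpace ℝ E]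
    [FiniteDimensional ℝ E] [MeasurableSpace E] [BorelSpace E] {p : E} (hp : ‖p‖ = 1)
    (F : E → ℝ≥0∞) (hF : Measurable F) :
    ∫⁻ x, F x = ∫⁻ s : ℝ, ∫⁻ y : (ℝ ∙ p)ᗮ, F (s • p + y) := by
  let e := (LinearIsometryEquiv.toSpanUnitSingleton (𝕜 := ℝ) p hp)
  have he : MeasurePreserving (Prod.map e id : ℝ × (ℝ ∙ p)ᗮ → _) :=
    e.measurePreserving.prod (.id _)
  have h := ((ℝ ∙ p).orthogonalDecomposition.symm.measurePreserving.comp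
    (WithLp.volume_preserving_toLp (ℝ ∙ p) (ℝ ∙ p)ᗮ)).comp he
  rw [← h.lintegral_comp hF, Measure.volume_eq_prod, lintegral_prod _ (by
    exact (hF.comp h.measurable).aemeasurable)]
  rfl

/-- The slice formula: under the surface measure of the unit sphere of an `(n + 2)`-dimensional
space, the angle to a fixed unit vector has density proportional to `sin θ ^ n` on `(0, π)`. -/
lemma lintegral_inner_toSphere {E : Type*} [NormedAddCommGroup E] [InnerProductSpace ℝ E]
    [FiniteDimensional ℝ E] [MeasurableSpace E] [BorelSpace E] {n : ℕ}
    (hn : Module.finrank ℝ E = n + 2) {p : E} (hp : ‖p‖ = 1) (f : ℝ → ℝ≥0∞) (hf : Measurable f) :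
    ∫⁻ ω : sphere (0 : E) 1, f ⟪p, ω⟫ ∂(volume : Measure E).toSphere =
      (volume : Measure (ℝ ∙ p)ᗮ).toSphere Set.univ *
        ∫⁻ θ in Set.Ioo 0 π, ENNReal.ofReal (Real.sin θ ^ n) * f (Real.cos θ) := by
  have : Nontrivial E := Module.nontrivial_of_finrank_pos (R := ℝ) (by omega)
  have hp0 : p ≠ 0 := by rintro rfl; simp at hp
  have : Fact (Module.finrank ℝ E = (n + 1) + 1) := ⟨hn⟩
  have hK : Module.finrank ℝ (ℝ ∙ p)ᗮ = n + 1 := Submodule.finrank_orthogonal_span_singleton hp0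
  have : Nontrivial (ℝ ∙ p)ᗮ := Module.nontrivial_of_finrank_pos (R := ℝ) (by omega)
  set h : ℝ → ℝ≥0∞ := (Set.Iio 1).indicator 1
  have hh : Measurable h := measurable_one.indicator measurableSet_Iio
  set R : ℝ≥0∞ := ∫⁻ r : Set.Ioi (0 : ℝ), h r ∂Measure.volumeIoiPow (n + 1) with hR
  have hR' : R = ENNReal.ofReal (1 / (n + 2)) := by
    have := Measure.volumeIoiPow_apply_Iio (n + 1) ⟨1, Set.mem_Ioi.2 one_pos⟩
    rw [← lintegral_indicator_one measurableSet_Iio] at this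
    rw [one_pow, show ((n + 1 : ℕ) : ℝ) + 1 = n + 2 by push_cast; ring] at this
    rw [hR, ← this]
    rfl
  have hR0 : R ≠ 0 := by rw [hR']; simp; positivity
  have hRt : R ≠ ∞ := by simp [hR']
  set G : E → ℝ≥0∞ := fun x ↦ f (⟪p, x⟫ / ‖x‖) * h ‖x‖ with hG
  have hGm : Measurable G := by fun_prop
  have h1 : ∫⁻ x, G x =
      (∫⁻ ω : sphere (0 : E) 1, f ⟪p, ω⟫ ∂(volume : Measure E).toSphere) * R := by
    rw [lintegral_eq_lintegral_toSphere _ _ hGm, hn, ← lintegral_mul_const _ (by fun_prop)]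
    refine lintegral_congr fun ω ↦ ?_
    rw [hR, show n + 2 - 1 = n + 1 by omega, ← lintegral_const_mul _ (by fun_prop)]
    refine lintegral_congr fun r ↦ ?_
    have hr : (0 : ℝ) < r := r.2
    have : (r : ℝ) * ⟪p, (ω : E)⟫ / r = ⟪p, (ω : E)⟫ := by field_simp
    simp [hG, norm_smul, abs_of_pos hr, inner_smul_right, this]
  set g : ℝ → ℝ → ℝ≥0∞ := fun s ρ ↦ f (s / √(s ^ 2 + ρ ^ 2)) * h √(s ^ 2 + ρ ^ 2) with hg
  have hGg (s : ℝ) (y : (ℝ ∙ p)ᗮ) : G (s • p + y) = g s ‖y‖ := by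
    have hy : ⟪p, (y : E)⟫ = 0 := Submodule.mem_orthogonal_singleton_iff_inner_right.1 y.2
    have hn : ‖s • p + (y : E)‖ = √(s ^ 2 + ‖y‖ ^ 2) := by
      rw [← Real.sqrt_sq (norm_nonneg (s • p + (y : E))), norm_add_sq_real]
      simp [inner_smul_left, hy, norm_smul, hp]
    simp [hG, hg, hn, inner_add_right, inner_smul_right, hy, hp]
  have h2 : ∫⁻ x, G x = (volume : Measure (ℝ ∙ p)ᗮ).toSphere Set.univ *
      ((∫⁻ θ in Set.Ioo 0 π, ENNReal.ofReal (Real.sin θ ^ n) * f (Real.cos θ)) * R) := by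
    rw [lintegral_eq_lintegral_orthogonal hp _ hGm]
    simp_rw [hGg]
    have hgm (s : ℝ) : Measurable (g s) := by fun_prop
    simp_rw [fun s ↦ lintegral_comp_norm (volume : Measure (ℝ ∙ p)ᗮ) (g s) (hgm s)]
    rw [hK, lintegral_const_mul']
    swap
    · exact measure_ne_top _ _
    congr 1
    set Φ : ℝ × ℝ → ℝ≥0∞ := fun q ↦ (Set.Ioi (0 : ℝ)).indicator
      (fun ρ ↦ ENNReal.ofReal (ρ ^ n) * g q.1 ρ) q.2 with hΦ
    have hΦm : Measurable Φ := by
      have : Φ = (Prod.snd ⁻¹' Set.Ioi (0 : ℝ)).indicator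
        (fun q ↦ ENNReal.ofReal (q.2 ^ n) * g q.1 q.2) := rfl
      rw [this]
      exact Measurable.indicator (by fun_prop) (measurable_snd measurableSet_Ioi)
    calc
      _ = ∫⁻ q, Φ q := by
        rw [Measure.volume_eq_prod, lintegral_prod _ hΦm.aemeasurable]
        refine lintegral_congr fun s ↦ ?_
        exact (lintegral_indicator measurableSet_Ioi _).symm
      _ = ∫⁻ q in Set.Ioi (0 : ℝ) ×ˢ Set.Ioo (-π) π, (ENNReal.ofReal (q.1 ^ (n + 1)) * h q.1) *
          (Set.Ioi (0 : ℝ)).indicator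
            (fun θ ↦ ENNReal.ofReal (Real.sin θ ^ n) * f (Real.cos θ)) q.2 := by
        rw [← lintegral_comp_polarCoord_symm]
        refine setLIntegral_congr_fun (measurableSet_Ioi.prod measurableSet_Ioo) ?_
        rintro ⟨r, θ⟩ ⟨hr : 0 < r, hθ, hθ'⟩
        dsimp only at hθ hθ' ⊢
        have hsq : √((r * Real.cos θ) ^ 2 + (r * Real.sin θ) ^ 2) = r := by
          rw [← Real.sqrt_sq hr.le]
          congr 1
          rw [Real.sqrt_sq hr.le]
          linear_combination r ^ 2 * Real.sin_sq_add_cos_sq θ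
        have hc : r * Real.cos θ / r = Real.cos θ := by field_simp
        by_cases h0 : 0 < θ
        · have hs := Real.sin_pos_of_pos_of_lt_pi h0 hθ'
          simp only [hΦ, hg, polarCoord_symm_apply, Set.indicator, Set.mem_Ioi, mul_pos hr hs, h0,
            if_true, hsq, hc, smul_eq_mul]
          simp only [mul_pow, pow_succ, ENNReal.ofReal_mul (pow_nonneg hr.le n)]
          ring
        · have hs := Real.sin_nonpos_of_nonpos_of_neg_pi_le (not_lt.1 h0) hθ.le
          have : ¬ 0 < r * Real.sin θ := not_lt.2 (mul_nonpos_of_nonneg_of_nonpos hr.le hs)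
          simp [hΦ, this, h0]
      _ = _ := by
        rw [Measure.volume_eq_prod, ← Measure.prod_restrict, lintegral_prod_mul
          (f := fun r ↦ ENNReal.ofReal (r ^ (n + 1)) * h r)
          (g := (Set.Ioi (0 : ℝ)).indicator
            fun θ ↦ ENNReal.ofReal (Real.sin θ ^ n) * f (Real.cos θ)) (by fun_prop) (by
            exact (Measurable.indicator (by fun_prop) measurableSet_Ioi).aemeasurable),
          lintegral_indicator measurableSet_Ioi, Measure.restrict_restrict measurableSet_Ioi,
          hR, lintegral_volumeIoiPow _ _ hh, mul_comm]
        congr 3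
        ext θ
        simp only [Set.mem_inter_iff, Set.mem_Ioi, Set.mem_Ioo]
        constructor
        · rintro ⟨h1, -, h2⟩; exact ⟨h1, h2⟩
        · rintro ⟨h1, h2⟩; exact ⟨h1, by linarith, h2⟩
  rw [← ENNReal.mul_left_inj hR0 hRt, ← h1, h2, mul_assoc]
lemma betaFn_eq_beta {a b : ℝ} (ha : 0 < a) (hb : 0 < b) :
    betaFn a b = ProbabilityTheory.beta a b := by
  rw [ProbabilityTheory.beta_eq_betaIntegralReal a b ha hb, ← Complex.ofReal_re (betaFn a b)]
  congr 1
  rw [betaFn, incBeta, Complex.betaIntegral, ← intervalIntegral.integral_ofReal]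
  refine intervalIntegral.integral_congr fun t ht ↦ ?_
  rw [Set.uIcc_of_le zero_le_one] at ht
  have := ht.2
  rw [Complex.ofReal_mul, Complex.ofReal_cpow ht.1, Complex.ofReal_cpow (by linarith)]
  push_cast
  rfl

lemma lintegral_rpow_mul_one_sub_rpow {a b : ℝ} (ha : 0 < a) (hb : 0 < b) :
    ∫⁻ t in Set.Ioo (0 : ℝ) 1, ENNReal.ofReal (t ^ (a - 1) * (1 - t) ^ (b - 1)) =
      ENNReal.ofReal (ProbabilityTheory.beta a b) := by
  have hpos := ProbabilityTheory.beta_pos ha hb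
  have h := ProbabilityTheory.lintegral_betaPDF_eq_one ha hb
  rw [ProbabilityTheory.lintegral_betaPDF] at h
  simp_rw [mul_assoc, ENNReal.ofReal_mul (one_div_nonneg.2 hpos.le)] at h
  rw [lintegral_const_mul' _ _ ENNReal.ofReal_ne_top, one_div, ENNReal.ofReal_inv_of_pos hpos] at h
  exact (ENNReal.eq_inv_of_mul_eq_one_left ((mul_comm _ _).trans h)).trans (inv_inv _)

lemma image_half_one_sub_cos :
    (fun θ ↦ (1 - Real.cos θ) / 2) '' Set.Ioo 0 π = Set.Ioo 0 1 := by
  ext t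
  constructor
  · rintro ⟨θ, ⟨h0, hπ⟩, rfl⟩
    have h1 := Real.cos_lt_cos_of_nonneg_of_le_pi le_rfl hπ.le h0
    have h2 := Real.cos_lt_cos_of_nonneg_of_le_pi h0.le le_rfl hπ
    rw [Real.cos_zero] at h1
    rw [Real.cos_pi] at h2
    constructor <;> dsimp only <;> linarith
  · rintro ⟨h0, h1⟩
    refine ⟨Real.arccos (1 - 2 * t), ⟨Real.arccos_pos.2 (by linarith), ?_⟩, ?_⟩
    · refine lt_of_le_of_ne (Real.arccos_le_pi _) fun h ↦ ?_
      have := Real.arccos_eq_pi.1 h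
      linarith
    · dsimp only
      rw [Real.cos_arccos (by linarith) (by linarith)]
      ring

lemma lintegral_sin_half_rpow_mul_cos_half_rpow {a b : ℝ} (ha : 0 < a) (hb : 0 < b) :
    ∫⁻ θ in Set.Ioo 0 π, ENNReal.ofReal
        (Real.sin (θ / 2) ^ (2 * a - 1) * Real.cos (θ / 2) ^ (2 * b - 1)) =
      ENNReal.ofReal (ProbabilityTheory.beta a b) := by
  rw [← lintegral_rpow_mul_one_sub_rpow ha hb, ← image_half_one_sub_cos,
    lintegral_image_eq_lintegral_abs_deriv_mul measurableSet_Ioo (f' := fun θ ↦ Real.sin θ / 2)]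
  · refine setLIntegral_congr_fun measurableSet_Ioo fun θ hθ ↦ ?_
    have hs : 0 < Real.sin (θ / 2) :=
      Real.sin_pos_of_pos_of_lt_pi (by linarith [hθ.1]) (by linarith [hθ.1, hθ.2])
    have hc : 0 < Real.cos (θ / 2) :=
      Real.cos_pos_of_mem_Ioo ⟨by linarith [hθ.1, Real.pi_pos], by linarith [hθ.2]⟩
    have h2 : θ = 2 * (θ / 2) := by ring
    have h3 : Real.sin θ / 2 = Real.sin (θ / 2) * Real.cos (θ / 2) := by
      nth_rw 1 [h2]
      rw [Real.sin_two_mul]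
      ring
    have h4 : (1 - Real.cos θ) / 2 = Real.sin (θ / 2) ^ (2 : ℝ) := by
      nth_rw 1 [h2]
      rw [Real.cos_two_mul, Real.rpow_two, Real.sin_sq]
      ring
    have h5 : 1 - Real.sin (θ / 2) ^ (2 : ℝ) = Real.cos (θ / 2) ^ (2 : ℝ) := by
      rw [Real.rpow_two, Real.rpow_two, Real.cos_sq']
    rw [h3, h4, h5, abs_of_pos (by positivity), ← ENNReal.ofReal_mul (by positivity),
      ← Real.rpow_mul hs.le, ← Real.rpow_mul hc.le]
    congr 1
    rw [show 2 * a - 1 = 1 + 2 * (a - 1) by ring, show 2 * b - 1 = 1 + 2 * (b - 1) by ring,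
      Real.rpow_add hs, Real.rpow_add hc, Real.rpow_one, Real.rpow_one]
    ring
  · intro θ _
    have := ((Real.hasDerivAt_cos θ).const_sub 1).div_const 2
    rw [neg_neg] at this
    exact this.hasDerivWithinAt
  · intro x hx y hy hxy
    exact Real.injOn_cos (Set.Ioo_subset_Icc_self hx) (Set.Ioo_subset_Icc_self hy)
      (by dsimp only at hxy; linarith)

lemma sin_eq_two_mul_half (θ : ℝ) : Real.sin θ = 2 * Real.sin (θ / 2) * Real.cos (θ / 2) := by
  rw [← Real.sin_two_mul, mul_div_cancel₀ θ two_ne_zero]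

lemma lintegral_sin_half_pow_mul_cos_half_pow (k m : ℕ) :
    ∫⁻ θ in Set.Ioo 0 π, ENNReal.ofReal (Real.sin (θ / 2) ^ k * Real.cos (θ / 2) ^ m) =
      ENNReal.ofReal (ProbabilityTheory.beta ((k + 1) / 2) ((m + 1) / 2)) := by
  rw [← lintegral_sin_half_rpow_mul_cos_half_rpow (by positivity) (by positivity)]
  simp_rw [mul_div_cancel₀ _ (two_ne_zero (α := ℝ)), add_sub_cancel_right, Real.rpow_natCast]

lemma lintegral_sin_pow (n : ℕ) :
    ∫⁻ θ in Set.Ioo 0 π, ENNReal.ofReal (Real.sin θ ^ n) =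
      ENNReal.ofReal (2 ^ n * ProbabilityTheory.beta ((n + 1) / 2) ((n + 1) / 2)) := by
  rw [ENNReal.ofReal_mul (by positivity), ← lintegral_sin_half_pow_mul_cos_half_pow,
    ← lintegral_const_mul' _ _ ENNReal.ofReal_ne_top]
  refine lintegral_congr fun θ ↦ ?_
  rw [← ENNReal.ofReal_mul (by positivity), sin_eq_two_mul_half, mul_pow, mul_pow, mul_assoc]

lemma lintegral_sin_pow_mul_sqrt (n : ℕ) :
    ∫⁻ θ in Set.Ioo 0 π, ENNReal.ofReal (Real.sin θ ^ n) *
        ENNReal.ofReal √(2 - 2 * Real.cos θ) =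
      ENNReal.ofReal (2 ^ (n + 1) * ProbabilityTheory.beta ((n + 2) / 2) ((n + 1) / 2)) := by
  rw [show ((n : ℝ) + 2) / 2 = ((n + 1 : ℕ) + 1) / 2 by push_cast; ring,
    ENNReal.ofReal_mul (by positivity), ← lintegral_sin_half_pow_mul_cos_half_pow,
    ← lintegral_const_mul' _ _ ENNReal.ofReal_ne_top]
  refine setLIntegral_congr_fun measurableSet_Ioo fun θ hθ ↦ ?_
  have hs : 0 < Real.sin (θ / 2) :=
    Real.sin_pos_of_pos_of_lt_pi (by linarith [hθ.1]) (by linarith [hθ.1, hθ.2])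
  have h : √(2 - 2 * Real.cos θ) = 2 * Real.sin (θ / 2) := by
    rw [← Real.sqrt_sq (by positivity : 0 ≤ 2 * Real.sin (θ / 2))]
    congr 1
    nth_rw 1 [show θ = 2 * (θ / 2) by ring]
    rw [Real.cos_two_mul, mul_pow, Real.sin_sq]
    ring
  rw [← ENNReal.ofReal_mul' (Real.sqrt_nonneg _), ← ENNReal.ofReal_mul (by positivity), h,
    sin_eq_two_mul_half]
  congr 1
  ring

lemma beta_div_beta_eq (n : ℕ) :
    2 ^ (n + 1) * ProbabilityTheory.beta ((n + 2) / 2) ((n + 1) / 2) /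
        (2 ^ n * ProbabilityTheory.beta ((n + 1) / 2) ((n + 1) / 2)) =
      2 ^ (n + 1) * ProbabilityTheory.beta ((n + 2) / 2) ((n + 2) / 2) /
        ProbabilityTheory.beta (n + 2 - 1 / 2) (1 / 2) := by
  have h := Real.Gamma_mul_Gamma_add_half (((n : ℝ) + 1) / 2)
  rw [show ((n : ℝ) + 1) / 2 + 1 / 2 = (n + 2) / 2 by ring,
    show 2 * (((n : ℝ) + 1) / 2) = n + 1 by ring, ← Real.Gamma_one_half_eq,
    show (1 : ℝ) - (n + 1) = -(n : ℝ) by ring, Real.rpow_neg zero_le_two, Real.rpow_natCast] at h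
  simp only [ProbabilityTheory.beta]
  rw [show ((n : ℝ) + 2) / 2 + (n + 1) / 2 = n + 2 - 1 / 2 by ring,
    show ((n : ℝ) + 1) / 2 + (n + 1) / 2 = n + 1 by ring,
    show ((n : ℝ) + 2) / 2 + (n + 2) / 2 = n + 2 by ring,
    show (n : ℝ) + 2 - 1 / 2 + 1 / 2 = n + 2 by ring]
  have h1 : 0 < Real.Gamma ((n : ℝ) + 2 - 1 / 2) :=
    Real.Gamma_pos_of_pos (by linarith [n.cast_nonneg (α := ℝ)])
  have h2 : 0 < Real.Gamma ((n : ℝ) + 1) := Real.Gamma_pos_of_pos (by positivity)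
  have h3 : 0 < Real.Gamma ((n : ℝ) + 2) := Real.Gamma_pos_of_pos (by positivity)
  have h4 : 0 < Real.Gamma (((n : ℝ) + 1) / 2) := Real.Gamma_pos_of_pos (by positivity)
  have h5 : 0 < Real.Gamma (1 / 2) := Real.Gamma_pos_of_pos (by positivity)
  generalize Real.Gamma (((n : ℝ) + 2) / 2) = x at *
  generalize Real.Gamma ((n : ℝ) + 2 - 1 / 2) = y at *
  generalize Real.Gamma ((n : ℝ) + 1) = z at *
  generalize Real.Gamma ((n : ℝ) + 2) = w at *
  generalize Real.Gamma (((n : ℝ) + 1) / 2) = u at *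
  generalize Real.Gamma (1 / 2) = v at *
  field_simp at h ⊢
  linear_combination -x * h

theorem sphere_chord_mean (N : ℕ) (hN : 2 ≤ N)
    (p : EuclideanSpace ℝ (Fin N)) (hp : ‖p‖ = 1) :
    ∫ x, ‖x - p‖ ∂(uniformOnSphere N) =
      2 ^ (N - 1) * betaFn ((N : ℝ) / 2) ((N : ℝ) / 2) /
        betaFn ((N : ℝ) - 1 / 2) (1 / 2) := by
  obtain ⟨n, rfl⟩ := Nat.exists_eq_add_of_le' hN
  have hdim : Module.finrank ℝ (EuclideanSpace ℝ (Fin (n + 2))) = n + 2 := finrank_euclideanSpace_fin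
  have hn : (0 : ℝ) ≤ n := n.cast_nonneg
  set σ := (volume : Measure (EuclideanSpace ℝ (Fin (n + 2)))).toSphere with hσ
  set c := (volume : Measure (ℝ ∙ p)ᗮ).toSphere Set.univ with hc
  have hcpos : c.toReal ≠ 0 := by
    have hp0 : p ≠ 0 := by rintro rfl; simp at hp
    have : Fact (Module.finrank ℝ (EuclideanSpace ℝ (Fin (n + 2))) = (n + 1) + 1) := ⟨hdim⟩
    have hK := Submodule.finrank_orthogonal_span_singleton (𝕜 := ℝ) (n := n + 1) hp0
    refine ENNReal.toReal_ne_zero.2 ⟨?_, measure_ne_top _ _⟩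
    rw [hc, Ne, Measure.measure_univ_eq_zero, Measure.toSphere_eq_zero_iff_finrank]
    omega
  have htotal : σ Set.univ =
      c * ENNReal.ofReal (2 ^ n * ProbabilityTheory.beta ((n + 1) / 2) ((n + 1) / 2)) := by
    have := lintegral_inner_toSphere hdim hp 1 measurable_one
    simpa only [Pi.one_apply, mul_one, lintegral_one, lintegral_sin_pow] using this
  have hchord : ∫ ω : sphere (0 : EuclideanSpace ℝ (Fin (n + 2))) 1, ‖(ω : _) - p‖ ∂σ =
      c.toReal * (2 ^ (n + 1) * ProbabilityTheory.beta ((n + 2) / 2) ((n + 1) / 2)) := by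
    have hβ := ProbabilityTheory.beta_pos (α := ((n : ℝ) + 2) / 2) (β := ((n : ℝ) + 1) / 2)
      (by positivity) (by positivity)
    rw [integral_eq_lintegral_of_nonneg_ae (.of_forall fun _ ↦ norm_nonneg _) (by fun_prop),
      ← ENNReal.toReal_ofReal (by positivity : 0 ≤ 2 ^ (n + 1) *
        ProbabilityTheory.beta (((n : ℝ) + 2) / 2) (((n : ℝ) + 1) / 2)),
      ← ENNReal.toReal_mul, ← lintegral_sin_pow_mul_sqrt,
      ← lintegral_inner_toSphere hdim hp (fun t ↦ ENNReal.ofReal √(2 - 2 * t)) (by fun_prop)]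
    congr 1
    refine lintegral_congr fun ω ↦ ?_
    have hω : ‖(ω : EuclideanSpace ℝ (Fin (n + 2)))‖ = 1 := norm_eq_of_mem_sphere ω
    rw [← Real.sqrt_sq (norm_nonneg (_ - p)), norm_sub_sq_real, hω, hp, real_inner_comm]
    ring_nf
  have hβ := ProbabilityTheory.beta_pos (α := ((n : ℝ) + 1) / 2) (β := ((n : ℝ) + 1) / 2)
    (by positivity) (by positivity)
  have hratio := beta_div_beta_eq n
  rw [betaFn_eq_beta (by positivity) (by positivity),
    betaFn_eq_beta (by push_cast; linarith) (by positivity), show n + 2 - 1 = n + 1 by omega]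
  push_cast
  rw [← hratio, uniformOnSphere,
    (MeasurableEmbedding.subtype_coe isClosed_sphere.measurableSet).integral_map,
    integral_smul_measure, hchord, ← hσ, htotal, ENNReal.toReal_inv, ENNReal.toReal_mul,
    ENNReal.toReal_ofReal (by positivity), smul_eq_mul]
  field_simp
end

section
/- The probability that a random chord of the unit sphere S^{N-1} is shorter than the radius is P(D ≤ 1) = (1/2)·I_{3/4}((N-1)/2, 1/2), where I is the regularized incomplete beta function. -/
open MeasureTheory Metric

open Real in
/-- Substituting `s = cos θ` in the integral of the volumes of the slices of a ball. -/
lemma integral_sqrt_one_sub_sq_pow (n : ℕ) {a b : ℝ} (ha : 0 ≤ a) (hab : a ≤ b) (hb : b ≤ π) :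
    ∫ s in cos b..cos a, √(1 - s ^ 2) ^ n = ∫ θ in a..b, sin θ ^ (n + 1) := by
  rw [← intervalIntegral.integral_deriv_smul_comp (f := cos) (f' := fun θ ↦ -sin θ)
      (fun θ _ ↦ hasDerivAt_cos θ) (by fun_prop) (by fun_prop),
    intervalIntegral.integral_symm, ← intervalIntegral.integral_neg]
  refine intervalIntegral.integral_congr fun θ hθ ↦ ?_
  rw [Set.uIcc_of_le hab] at hθ
  have h := sin_nonneg_of_nonneg_of_le_pi (ha.trans hθ.1) (hθ.2.trans hb)
  have h' : 1 - cos θ ^ 2 = sin θ ^ 2 := by rw [sin_sq]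
  simp only [Function.comp, h', sqrt_sq h, smul_eq_mul]
  ring

open Real in
lemma incBeta_sin_sq (m : ℕ) {φ : ℝ} (h0 : 0 ≤ φ) (hφ : φ ≤ π / 2) :
    incBeta (sin φ ^ 2) (((m : ℝ) + 1) / 2) (1 / 2) = 2 * ∫ θ in 0..φ, sin θ ^ m := by
  have key := intervalIntegral.integral_deriv_smul_comp_of_deriv_nonneg
    (f := fun θ ↦ sin θ ^ 2) (f' := fun θ ↦ 2 * sin θ * cos θ) (a := 0) (b := φ)
    (g := fun t : ℝ ↦ t ^ (((m : ℝ) + 1) / 2 - 1) * (1 - t) ^ ((1 / 2 : ℝ) - 1))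
    (by fun_prop) (fun θ _ ↦ by simpa using (hasDerivAt_sin θ).fun_pow 2) ?_
  · simp only [sin_zero, ne_eq, OfNat.ofNat_ne_zero, not_false_eq_true, zero_pow] at key
    rw [incBeta, ← key, ← intervalIntegral.integral_const_mul,
      intervalIntegral.integral_of_le h0, intervalIntegral.integral_of_le h0,
      integral_Ioc_eq_integral_Ioo, integral_Ioc_eq_integral_Ioo]
    refine setIntegral_congr_fun measurableSet_Ioo fun θ hθ ↦ ?_
    have hs : 0 < sin θ := sin_pos_of_pos_of_lt_pi hθ.1 (by linarith [hθ.2, pi_pos])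
    have hc : 0 < cos θ := cos_pos_of_mem_Ioo ⟨by linarith [hθ.1, pi_pos], by linarith [hθ.2]⟩
    have h1 : (sin θ ^ 2) ^ (((m : ℝ) + 1) / 2 - 1) = sin θ ^ m / sin θ := by
      rw [← rpow_natCast (sin θ) 2, ← rpow_mul hs.le, ← rpow_natCast (sin θ) m,
        ← rpow_sub_one hs.ne']
      congr 1
      push_cast
      ring
    have h2 : (1 - sin θ ^ 2) ^ ((1 / 2 : ℝ) - 1) = (cos θ)⁻¹ := by
      rw [← cos_sq', ← rpow_natCast (cos θ) 2, ← rpow_mul hc.le, ← rpow_neg_one]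
      norm_num
    simp only [Function.comp, smul_eq_mul, h1, h2]
    field_simp
  · intro θ hθ
    rw [min_eq_left h0, max_eq_right h0] at hθ
    have := sin_nonneg_of_nonneg_of_le_pi hθ.1.le (by linarith [hθ.2, pi_pos])
    have := cos_nonneg_of_neg_pi_div_two_le_of_le (x := θ)
      (by linarith [hθ.1, pi_pos]) (by linarith [hθ.2])
    positivity

open Real in
lemma integral_sin_pow_zero_pi (m : ℕ) :
    ∫ θ in 0..π, sin θ ^ m = 2 * ∫ θ in 0..(π / 2), sin θ ^ m := by
  have hi (a b : ℝ) : IntervalIntegrable (fun θ ↦ sin θ ^ m) volume a b :=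
    (by fun_prop : Continuous fun θ ↦ sin θ ^ m).intervalIntegrable a b
  have h := intervalIntegral.integral_comp_sub_left (fun θ ↦ sin θ ^ m) π (a := 0) (b := π / 2)
  simp only [sin_pi_sub, sub_zero, show π - π / 2 = π / 2 by ring] at h
  rw [← intervalIntegral.integral_add_adjacent_intervals (hi 0 (π / 2)) (hi (π / 2) π), ← h,
    two_mul]

/-- Cartesian coordinates with a prescribed first axis. -/
lemma exists_measurePreserving_prod {n : ℕ} {p : EuclideanSpace ℝ (Fin (n + 1))} (hp : ‖p‖ = 1) :
    ∃ Φ : EuclideanSpace ℝ (Fin (n + 1)) → ℝ × EuclideanSpace ℝ (Fin n),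
      MeasurePreserving Φ volume (volume.prod volume) ∧
      (∀ x, (Φ x).1 = inner ℝ p x) ∧ ∀ x, ‖x‖ ^ 2 = (Φ x).1 ^ 2 + ‖(Φ x).2‖ ^ 2 := by
  obtain ⟨b, hb⟩ := Orthonormal.exists_orthonormalBasis_extension_of_card_eq
    (𝕜 := ℝ) (E := EuclideanSpace ℝ (Fin (n + 1))) (ι := Fin (n + 1)) (by simp)
    (v := fun _ ↦ p) (s := {0}) (by
      constructor
      · intro i; simpa using hp
      · intro i j hij; exact absurd (Subsingleton.elim i j) hij)
  refine ⟨_, ((MeasurePreserving.id volume).prod (PiLp.volume_preserving_toLp (Fin n))).comp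
    ((volume_preserving_piFinSuccAbove (fun _ ↦ ℝ) 0).comp
      ((PiLp.volume_preserving_ofLp (Fin (n + 1))).comp b.measurePreserving_repr)), ?_, ?_⟩
  · intro x
    rw [← hb 0 rfl, ← b.repr_apply_apply]
    rfl
  · intro x
    rw [← b.repr.norm_map x, EuclideanSpace.norm_sq_eq, EuclideanSpace.norm_sq_eq,
      Fin.sum_univ_succ]
    simp [MeasurableEquiv.piFinSuccAbove, Fin.tail, Fin.insertNthEquiv]

open Real in
lemma volume_ball_sqrt_one_sub_sq {n : ℕ} (hn : n ≠ 0) (s : ℝ) :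
    volume {y : EuclideanSpace ℝ (Fin n) | s ^ 2 + ‖y‖ ^ 2 < 1} =
      ENNReal.ofReal (√(1 - s ^ 2) ^ n) * volume (ball (0 : EuclideanSpace ℝ (Fin n)) 1) := by
  have : Nonempty (Fin n) := ⟨⟨0, Nat.pos_of_ne_zero hn⟩⟩
  have hset : {y : EuclideanSpace ℝ (Fin n) | s ^ 2 + ‖y‖ ^ 2 < 1} = ball 0 √(1 - s ^ 2) := by
    ext y
    rw [Set.mem_ofPred_eq, mem_ball_zero_iff, lt_sqrt (norm_nonneg y)]
    constructor <;> intro h <;> linarith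
  rw [hset, Measure.addHaar_ball _ _ (sqrt_nonneg _)]
  simp

open Real in
lemma volume_ball_eq_integral_sin_pow (m : ℕ) :
    volume (ball (0 : EuclideanSpace ℝ (Fin (m + 2))) 1) =
      ENNReal.ofReal (((m : ℝ) + 1) / (m + 2) * ∫ θ in 0..π, sin θ ^ m) *
        volume (ball (0 : EuclideanSpace ℝ (Fin (m + 1))) 1) := by
  obtain ⟨Φ, hΦ, -, hnorm⟩ := exists_measurePreserving_prod
    (p := EuclideanSpace.single (0 : Fin (m + 2)) (1 : ℝ)) (by simp)
  set T : Set (ℝ × EuclideanSpace ℝ (Fin (m + 1))) := {z | z.1 ^ 2 + ‖z.2‖ ^ 2 < 1} with hT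
  have hTm : MeasurableSet T := measurableSet_lt (by fun_prop) (by fun_prop)
  have hball : ball (0 : EuclideanSpace ℝ (Fin (m + 2))) 1 = Φ ⁻¹' T := by
    ext x
    simp only [mem_ball_zero_iff, hT, Set.mem_preimage, Set.mem_ofPred_eq, ← hnorm]
    rw [sq_lt_one_iff₀ (norm_nonneg x)]
  have hsupp : Function.support (fun s : ℝ ↦ √(1 - s ^ 2) ^ (m + 1)) ⊆ Set.Ioc (-1) 1 := by
    intro s hs
    have hs' : √(1 - s ^ 2) ≠ 0 := fun h ↦ hs (by simp [h])
    have := sqrt_ne_zero'.1 hs'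
    constructor <;> nlinarith
  have hint : Integrable (fun s : ℝ ↦ √(1 - s ^ 2) ^ (m + 1)) := by
    rw [← integrableOn_iff_integrable_of_support_subset (hsupp.trans Set.Ioc_subset_Icc_self)]
    exact (by fun_prop : Continuous fun s : ℝ ↦ √(1 - s ^ 2) ^ (m + 1)).integrableOn_Icc
  have hcos := integral_sqrt_one_sub_sq_pow (m + 1) le_rfl pi_pos.le le_rfl
  rw [cos_pi, cos_zero, integral_sin_pow] at hcos
  rw [hball, hΦ.measure_preimage hTm.nullMeasurableSet, Measure.prod_apply hTm]
  simp only [hT, Set.preimage_ofPred_eq, volume_ball_sqrt_one_sub_sq m.succ_ne_zero]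
  rw [lintegral_mul_const _ (by fun_prop),
    ← ofReal_integral_eq_lintegral_ofReal hint (.of_forall fun s ↦ by positivity),
    ← intervalIntegral.integral_eq_integral_of_support_subset hsupp, hcos]
  simp

open Real in
/-- The volume of the sector of the unit ball with axis `p` and half-angle `π / 3`. -/
lemma volume_sector_eq_integral_sin_pow (m : ℕ) {p : EuclideanSpace ℝ (Fin (m + 2))}
    (hp : ‖p‖ = 1) :
    volume {x | 0 < ‖x‖ ∧ ‖x‖ < 1 ∧ ‖x‖ ≤ 2 * inner ℝ p x} =
      ENNReal.ofReal (((m : ℝ) + 1) / (m + 2) * ∫ θ in 0..(π / 3), sin θ ^ m) *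
        volume (ball (0 : EuclideanSpace ℝ (Fin (m + 1))) 1) := by
  obtain ⟨Φ, hΦ, hfst, hnorm⟩ := exists_measurePreserving_prod hp
  set T : Set (ℝ × EuclideanSpace ℝ (Fin (m + 1))) :=
    {z | 0 < z.1 ∧ z.1 ^ 2 + ‖z.2‖ ^ 2 < 1 ∧ ‖z.2‖ ^ 2 ≤ 3 * z.1 ^ 2} with hT
  have hTm : MeasurableSet T := by
    rw [hT, Set.ofPred_and, Set.ofPred_and]
    exact (measurableSet_lt (by fun_prop) (by fun_prop)).inter
      ((measurableSet_lt (by fun_prop) (by fun_prop)).inter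
        (measurableSet_le (by fun_prop) (by fun_prop)))
  have hsector : {x | 0 < ‖x‖ ∧ ‖x‖ < 1 ∧ ‖x‖ ≤ 2 * inner ℝ p x} = Φ ⁻¹' T := by
    ext x
    simp only [hT, Set.mem_preimage, Set.mem_ofPred_eq, ← hnorm]
    rw [sq_lt_one_iff₀ (norm_nonneg x), ← hfst]
    have hx := norm_nonneg x
    have h2 := hnorm x
    constructor
    · rintro ⟨h, h', h''⟩
      exact ⟨by linarith, h', by nlinarith⟩
    · rintro ⟨h, h', h''⟩
      refine ⟨?_, h', abs_le_of_sq_le_sq' (by nlinarith) (by linarith) |>.2⟩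
      refine hx.lt_of_ne fun h0 ↦ ?_
      rw [← h0] at h2
      nlinarith [sq_nonneg ‖(Φ x).2‖]
  set V := volume (ball (0 : EuclideanSpace ℝ (Fin (m + 1))) 1)
  have hslice : (fun s : ℝ ↦ volume (Prod.mk s ⁻¹' T)) =ᵐ[volume] fun s ↦
      (Set.Ioc 0 (1 / 2)).indicator (fun s ↦ ENNReal.ofReal ((√3 * s) ^ (m + 1)) * V) s +
      (Set.Ioc (1 / 2) 1).indicator (fun s ↦ ENNReal.ofReal (√(1 - s ^ 2) ^ (m + 1)) * V) s := by
    filter_upwards [Measure.ae_ne volume (1 / 2 : ℝ)] with s hs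
    simp only [hT, Set.preimage_ofPred_eq]
    rcases le_or_gt s 0 with h0 | h0
    · simp [Set.indicator, h0.not_gt, not_lt.2 (h0.trans (by norm_num : (0:ℝ) ≤ 2⁻¹))]
    rcases lt_or_gt_of_ne hs with h1 | h1
    · have hset : {y : EuclideanSpace ℝ (Fin (m + 1)) |
          0 < s ∧ s ^ 2 + ‖y‖ ^ 2 < 1 ∧ ‖y‖ ^ 2 ≤ 3 * s ^ 2} = closedBall 0 (√3 * s) := by
        ext y
        rw [Set.mem_ofPred_eq, mem_closedBall_zero_iff,
          ← pow_le_pow_iff_left₀ (norm_nonneg y) (by positivity) two_ne_zero, mul_pow,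
          sq_sqrt (by norm_num)]
        exact ⟨fun h ↦ h.2.2, fun h ↦ ⟨h0, by nlinarith, h⟩⟩
      rw [Set.indicator_of_mem (Set.mem_Ioc.2 ⟨h0, h1.le⟩), Set.indicator_of_notMem fun h ↦ h1.not_gt h.1,
        add_zero, hset, Measure.addHaar_closedBall _ _ (by positivity)]
      simp [V]
    · have hset : {y : EuclideanSpace ℝ (Fin (m + 1)) |
          0 < s ∧ s ^ 2 + ‖y‖ ^ 2 < 1 ∧ ‖y‖ ^ 2 ≤ 3 * s ^ 2} = {y | s ^ 2 + ‖y‖ ^ 2 < 1} := by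
        ext y
        exact ⟨fun h ↦ h.2.1, fun h ↦ ⟨h0, h, by
          have : s ^ 2 + ‖y‖ ^ 2 < 1 := h
          nlinarith⟩⟩
      rw [Set.indicator_of_notMem fun h ↦ h1.not_ge h.2, zero_add, hset,
        volume_ball_sqrt_one_sub_sq m.succ_ne_zero]
      by_cases h2 : s ≤ 1
      · rw [Set.indicator_of_mem (Set.mem_Ioc.2 ⟨h1, h2⟩)]
      · rw [Set.indicator_of_notMem fun h ↦ h2 h.2, sqrt_eq_zero_of_nonpos (by nlinarith)]
        simp
  have hcos := integral_sqrt_one_sub_sq_pow (m + 1) le_rfl (by positivity : 0 ≤ π / 3)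
    (by linarith [pi_pos])
  rw [cos_pi_div_three, cos_zero, integral_sin_pow] at hcos
  have hlin : ∫ s in (0 : ℝ)..(1 / 2), (√3 * s) ^ (m + 1) =
      (√3 / 2) ^ (m + 1) * (1 / 2) / (m + 2) := by
    simp only [mul_pow, intervalIntegral.integral_const_mul, integral_pow]
    push_cast
    field_simp
    ring
  have hlint (a b : ℝ) (hab : a ≤ b) (f : ℝ → ℝ) (hf : Continuous f)
      (h0 : ∀ s ∈ Set.Ioc a b, 0 ≤ f s) :
      ∫⁻ s in Set.Ioc a b, ENNReal.ofReal (f s) * V = ENNReal.ofReal (∫ s in a..b, f s) * V := by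
    rw [lintegral_mul_const _ (by fun_prop), intervalIntegral.integral_of_le hab,
      ofReal_integral_eq_lintegral_ofReal (hf.integrableOn_Icc.mono_set Set.Ioc_subset_Icc_self)]
    exact (ae_restrict_mem measurableSet_Ioc).mono h0
  rw [hsector, hΦ.measure_preimage hTm.nullMeasurableSet, Measure.prod_apply hTm,
    lintegral_congr_ae hslice, lintegral_add_left (by
      exact Measurable.indicator (by fun_prop) measurableSet_Ioc),
    lintegral_indicator measurableSet_Ioc, lintegral_indicator measurableSet_Ioc,
    hlint _ _ (by norm_num) (fun s ↦ (√3 * s) ^ (m + 1)) (by fun_prop)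
      (fun s hs ↦ by have := hs.1; positivity),
    hlint _ _ (by norm_num) (fun s ↦ √(1 - s ^ 2) ^ (m + 1)) (by fun_prop)
      (fun s hs ↦ by positivity), ← add_mul, ← ENNReal.ofReal_add, hlin, hcos]
  · congr 2
    rw [sin_pi_div_three, cos_pi_div_three, sin_zero]
    ring
  · rw [hlin]; positivity
  · rw [hcos]
    exact hcos ▸ intervalIntegral.integral_nonneg (by norm_num) fun s _ ↦ by positivity

open scoped Pointwise in
lemma Ioo_smul_sphere_inter_chord {E : Type*} [NormedAddCommGroup E] [InnerProductSpace ℝ E]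
    {p : E} (hp : ‖p‖ = 1) :
    Set.Ioo (0 : ℝ) 1 • ((↑) '' ((↑) ⁻¹' {x : E | ‖x - p‖ ≤ 1} : Set (sphere (0 : E) 1)) : Set E) =
      {x | 0 < ‖x‖ ∧ ‖x‖ < 1 ∧ ‖x‖ ≤ 2 * inner ℝ p x} := by
  have hchord (u : E) (hu : ‖u‖ = 1) : ‖u - p‖ ≤ 1 ↔ 1 ≤ 2 * inner ℝ p u := by
    rw [← sq_le_one_iff₀ (norm_nonneg _), norm_sub_sq_real, hu, hp, real_inner_comm]
    constructor <;> intro h <;> linarith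
  ext x
  simp only [Set.mem_smul, Subtype.image_preimage_coe, Set.mem_inter_iff, Set.mem_ofPred_eq,
    mem_sphere_zero_iff_norm]
  constructor
  · rintro ⟨r, ⟨hr0, hr1⟩, u, ⟨hu, hup⟩, rfl⟩
    rw [hchord u hu] at hup
    rw [norm_smul, hu, Real.norm_of_nonneg hr0.le, inner_smul_right]
    exact ⟨by linarith, by linarith, by nlinarith⟩
  · rintro ⟨h0, h1, h2⟩
    have hu : ‖‖x‖⁻¹ • x‖ = 1 := by simp [norm_smul, h0.ne']
    refine ⟨‖x‖, ⟨h0, h1⟩, ‖x‖⁻¹ • x, ⟨hu, (hchord _ hu).2 ?_⟩, by simp [h0.ne']⟩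
    rw [inner_smul_right]
    field_simp
    linarith

theorem sphere_chord_le_radius_prob (N : ℕ) (hN : 2 ≤ N)
    (p : EuclideanSpace ℝ (Fin N)) (hp : ‖p‖ = 1) :
    uniformOnSphere N {x | ‖x - p‖ ≤ 1} =
      ENNReal.ofReal ((1 / 2) * regIncBeta (3 / 4) (((N : ℝ) - 1) / 2) (1 / 2)) := by
  obtain ⟨m, rfl⟩ := Nat.exists_eq_add_of_le' hN
  have hmeas : MeasurableSet {x : EuclideanSpace ℝ (Fin (m + 2)) | ‖x - p‖ ≤ 1} :=
    measurableSet_le (by fun_prop) (by fun_prop)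
  have hpi := integral_sin_pow_pos m
  have hk : (0 : ℝ) < ((m : ℝ) + 1) / (m + 2) := by positivity
  have h34 := incBeta_sin_sq m (φ := Real.pi / 3) (by positivity) (by linarith [Real.pi_pos])
  have h1 := incBeta_sin_sq m (φ := Real.pi / 2) (by positivity) le_rfl
  rw [Real.sin_pi_div_three, show (√3 / 2) ^ 2 = (3 / 4 : ℝ) by
    rw [div_pow, Real.sq_sqrt (by norm_num)]; norm_num] at h34
  rw [Real.sin_pi_div_two, one_pow, ← integral_sin_pow_zero_pi] at h1
  have hcast : (((m + 2 : ℕ) : ℝ) - 1) / 2 = ((m : ℝ) + 1) / 2 := by push_cast; ring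
  have hV : volume (ball (0 : EuclideanSpace ℝ (Fin (m + 1))) 1) ≠ 0 :=
    (measure_ball_pos _ _ one_pos).ne'
  rw [hcast, regIncBeta, betaFn, h34, h1, uniformOnSphere,
    Measure.map_apply measurable_subtype_coe hmeas, Measure.smul_apply, smul_eq_mul,
    Measure.toSphere_apply' _ (measurable_subtype_coe hmeas), Measure.toSphere_apply_univ,
    Ioo_smul_sphere_inter_chord hp, volume_sector_eq_integral_sin_pow m hp,
    volume_ball_eq_integral_sin_pow, mul_comm, ← div_eq_mul_inv,
    ENNReal.mul_div_mul_left _ _ (by simp) (by simp),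
    ENNReal.mul_div_mul_right _ _ hV measure_ball_lt_top.ne,
    ← ENNReal.ofReal_div_of_pos (by positivity), mul_div_mul_left _ _ hk.ne']
  congr 1
  ring
end

section
/- Fix 0 < d < √2 and let F_N(d) = P(‖X - p‖ ≤ d) for X uniform on S^{N-1}. Then F_N(d) is strictly decreasing in N: for all N₂ > N₁ ≥ 2, F_{N₂}(d) < F_{N₁}(d). Equivalently, for √2 < d < 2, F_N(d) is strictly increasing in N. -/
open MeasureTheory Metric

open Real

section StandardGaussian

variable {E F : Type*}
  [NormedAddCommGroup E] [InnerProductSpace ℝ E] [FiniteDimensional ℝ E]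
  [MeasurableSpace E] [BorelSpace E]
  [NormedAddCommGroup F] [InnerProductSpace ℝ F] [FiniteDimensional ℝ F]
  [MeasurableSpace F] [BorelSpace F]

/-- The probability measure with density `exp (-π ‖x‖ ^ 2)` on a Euclidean space. -/
noncomputable def piGaussian (E : Type*) [NormedAddCommGroup E] [InnerProductSpace ℝ E]
    [FiniteDimensional ℝ E] [MeasurableSpace E] [BorelSpace E] : Measure E :=
  volume.withDensity fun x => ENNReal.ofReal (rexp (-π * ‖x‖ ^ 2))

omit [InnerProductSpace ℝ E] [FiniteDimensional ℝ E] in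
theorem measurable_piGaussian_density :
    Measurable fun x : E => ENNReal.ofReal (rexp (-π * ‖x‖ ^ 2)) := by
  fun_prop

instance isProbabilityMeasure_piGaussian : IsProbabilityMeasure (piGaussian E) := by
  constructor
  have h := GaussianFourier.integral_rexp_neg_mul_sq_norm (V := E) pi_pos
  rw [div_self pi_pos.ne', one_rpow] at h
  have hint : Integrable fun x : E => rexp (-π * ‖x‖ ^ 2) := by
    by_contra hn
    exact zero_ne_one ((integral_undef hn).symm.trans h)
  rw [piGaussian, withDensity_apply _ MeasurableSet.univ, Measure.restrict_univ,
    ← ofReal_integral_eq_lintegral_ofReal hint (.of_forall fun _ => (exp_pos _).le), h,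
    ENNReal.ofReal_one]

instance isOpenPosMeasure_piGaussian : (piGaussian E).IsOpenPosMeasure := by
  refine (withDensity_absolutelyContinuous' measurable_piGaussian_density.aemeasurable
    (.of_forall fun x => ?_)).isOpenPosMeasure
  simp [exp_pos]

theorem map_withDensity_eq_piGaussian {X : Type*} [MeasurableSpace X] {μ : Measure X}
    {e : X → F} (he : MeasurePreserving e μ) :
    (μ.withDensity fun x => ENNReal.ofReal (rexp (-π * ‖e x‖ ^ 2))).map e = piGaussian F := by
  ext s hs
  rw [Measure.map_apply he.measurable hs, withDensity_apply _ (he.measurable hs), piGaussian,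
    withDensity_apply _ hs,
    ← he.setLIntegral_comp_preimage hs measurable_piGaussian_density]

theorem piGaussian_prod_eq :
    (piGaussian E).prod (piGaussian F) = (volume : Measure (E × F)).withDensity
      fun z => ENNReal.ofReal (rexp (-π * (‖z.1‖ ^ 2 + ‖z.2‖ ^ 2))) := by
  rw [piGaussian, piGaussian,
    prod_withDensity measurable_piGaussian_density measurable_piGaussian_density]
  congr 1
  ext z
  rw [← ENNReal.ofReal_mul (exp_pos _).le, ← exp_add, mul_add]

omit [MeasurableSpace E] [BorelSpace E] in
theorem exists_orthonormalBasis_apply_eq {n : ℕ} (h : Module.finrank ℝ E = n) (i : Fin n)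
    {p : E} (hp : ‖p‖ = 1) : ∃ b : OrthonormalBasis (Fin n) ℝ E, b i = p := by
  obtain ⟨b, hb⟩ := Orthonormal.exists_orthonormalBasis_extension_of_card_eq (𝕜 := ℝ)
    (ι := Fin n) (by simpa using h) (v := fun _ => p) (s := {i})
    ⟨fun _ => hp, fun j k hjk => (hjk (Subsingleton.elim j k)).elim⟩
  exact ⟨b, hb i rfl⟩

omit [MeasurableSpace E] [BorelSpace E] [MeasurableSpace F] [BorelSpace F] in
theorem exists_linearIsometryEquiv_map_unit
    (h : Module.finrank ℝ E = Module.finrank ℝ F)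
    {p : E} {q : F} (hp : ‖p‖ = 1) (hq : ‖q‖ = 1) :
    ∃ e : E ≃ₗᵢ[ℝ] F, e p = q := by
  have : Nontrivial E := ⟨p, 0, by rintro rfl; simp at hp⟩
  let i : Fin (Module.finrank ℝ E) := ⟨0, Module.finrank_pos⟩
  obtain ⟨b, hb⟩ := exists_orthonormalBasis_apply_eq rfl i hp
  obtain ⟨b', hb'⟩ := exists_orthonormalBasis_apply_eq h.symm i hq
  refine ⟨b.equiv b' (Equiv.refl _), ?_⟩
  rw [← hb, OrthonormalBasis.equiv_apply_basis, Equiv.refl_apply, hb']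

/-- The solid circular cone around `p` whose half-angle has cosine `c`. -/
def circularCone (c : ℝ) (p : E) : Set E := {x | c * ‖x‖ ≤ inner ℝ x p}

omit [FiniteDimensional ℝ E] in
theorem measurableSet_circularCone (c : ℝ) (p : E) : MeasurableSet (circularCone c p) :=
  (isClosed_le (by fun_prop) (by fun_prop)).measurableSet

theorem piGaussian_circularCone_eq_prod (h : Module.finrank ℝ F = Module.finrank ℝ E + 1)
    (c : ℝ) {p : E} {q : F} (hp : ‖p‖ = 1) (hq : ‖q‖ = 1) :
    piGaussian F (circularCone c q) = (piGaussian E).prod (piGaussian ℝ)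
      {z | c * √(‖z.1‖ ^ 2 + z.2 ^ 2) ≤ inner ℝ z.1 p} := by
  have hp' : ‖WithLp.toLp 2 (p, (0 : ℝ))‖ = 1 := by
    simp [hp]
  have hdim : Module.finrank ℝ (WithLp 2 (E × ℝ)) = Module.finrank ℝ F := by
    rw [(WithLp.linearEquiv 2 ℝ (E × ℝ)).finrank_eq, Module.finrank_prod, Module.finrank_self, h]
  obtain ⟨e, rfl⟩ := exists_linearIsometryEquiv_map_unit hdim hp' hq
  have he : MeasurePreserving (fun z : E × ℝ => e (WithLp.toLp 2 z)) :=
    e.measurePreserving.comp (WithLp.volume_preserving_toLp E ℝ)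
  have hn (z : E × ℝ) : ‖e (WithLp.toLp 2 z)‖ = √(‖z.1‖ ^ 2 + z.2 ^ 2) := by
    simp [WithLp.prod_norm_eq_of_L2]
  rw [← map_withDensity_eq_piGaussian he,
    Measure.map_apply he.measurable (measurableSet_circularCone c _), piGaussian_prod_eq]
  congr 1
  · congr 1
    ext z
    rw [hn, sq_sqrt (by positivity), norm_eq_abs, sq_abs]
  · ext z
    simp only [circularCone, Set.mem_preimage, Set.mem_ofPred_eq, hn]
    rw [e.inner_map_map]
    simp [WithLp.prod_inner_apply]

theorem piGaussian_circularCone_eq_prod_univ (c : ℝ) (p : E) :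
    piGaussian E (circularCone c p) = (piGaussian E).prod (piGaussian ℝ)
      {z | c * ‖z.1‖ ≤ inner ℝ z.1 p} := by
  have : {z : E × ℝ | c * ‖z.1‖ ≤ inner ℝ z.1 p} = circularCone c p ×ˢ Set.univ := by
    ext; simp [circularCone]
  rw [this, Measure.prod_prod, measure_univ, mul_one]

theorem measure_lt_measure_of_isOpen_diff {X : Type*} [TopologicalSpace X] [MeasurableSpace X]
    [OpensMeasurableSpace X]
    {μ : Measure X} [IsFiniteMeasure μ] [μ.IsOpenPosMeasure] {s t u : Set X}
    (hst : s ⊆ t) (hu : IsOpen u) (hne : u.Nonempty) (hut : u ⊆ t) (hus : Disjoint s u) :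
    μ s < μ t :=
  calc μ s < μ s + μ u :=
        ENNReal.lt_add_right (measure_ne_top _ _) (hu.measure_pos μ hne).ne'
    _ = μ (s ∪ u) := (measure_union hus hu.measurableSet).symm
    _ ≤ μ t := measure_mono (Set.union_subset hst hut)

theorem piGaussian_circularCone_lt_of_pos (h : Module.finrank ℝ F = Module.finrank ℝ E + 1)
    {c : ℝ} (hc : 0 < c) (hc1 : c < 1) {p : E} {q : F} (hp : ‖p‖ = 1) (hq : ‖q‖ = 1) :
    piGaussian F (circularCone c q) < piGaussian E (circularCone c p) := by
  rw [piGaussian_circularCone_eq_prod h c hp hq, piGaussian_circularCone_eq_prod_univ]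
  refine measure_lt_measure_of_isOpen_diff (Set.ofPred_subset_ofPred.2 fun z hz => le_trans ?_ hz)
    (u := {z | c * ‖z.1‖ < inner ℝ z.1 p} ∩ {z | inner ℝ z.1 p < c * √(‖z.1‖ ^ 2 + z.2 ^ 2)})
    ((isOpen_lt (by fun_prop) (by fun_prop)).inter (isOpen_lt (by fun_prop) (by fun_prop)))
    ⟨(p, c⁻¹), by simpa [hp] using hc1, ?_⟩ (fun z hz => Set.mem_ofPred.2 (Set.mem_ofPred.1 hz.1).le)
    (Set.disjoint_left.2 fun z hz hz' => (Set.mem_ofPred.1 hz).not_gt hz'.2)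
  · gcongr
    exact le_sqrt_of_sq_le (by nlinarith [sq_nonneg z.2])
  · have : (1 : ℝ) < c * √(1 + (c⁻¹) ^ 2) := by
      rw [← div_lt_iff₀' hc]
      exact lt_sqrt_of_sq_lt (by rw [one_div]; linarith)
    simpa [hp] using this

theorem piGaussian_circularCone_lt_of_neg (h : Module.finrank ℝ F = Module.finrank ℝ E + 1)
    {c : ℝ} (hc : c < 0) (hc1 : -1 < c) {p : E} {q : F} (hp : ‖p‖ = 1) (hq : ‖q‖ = 1) :
    piGaussian E (circularCone c p) < piGaussian F (circularCone c q) := by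
  rw [piGaussian_circularCone_eq_prod h c hp hq, piGaussian_circularCone_eq_prod_univ]
  refine measure_lt_measure_of_isOpen_diff (Set.ofPred_subset_ofPred.2 fun z hz => le_trans ?_ hz)
    (u := {z | c * √(‖z.1‖ ^ 2 + z.2 ^ 2) < inner ℝ z.1 p} ∩ {z | inner ℝ z.1 p < c * ‖z.1‖})
    ((isOpen_lt (by fun_prop) (by fun_prop)).inter (isOpen_lt (by fun_prop) (by fun_prop)))
    ⟨(-p, c⁻¹), ?_, by simpa [hp] using hc1⟩ (fun z hz => Set.mem_ofPred.2 (Set.mem_ofPred.1 hz.1).le)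
    (Set.disjoint_left.2 fun z hz hz' => (Set.mem_ofPred.1 hz).not_gt hz'.2)
  · exact mul_le_mul_of_nonpos_left (le_sqrt_of_sq_le (by nlinarith [sq_nonneg z.2])) hc.le
  · have : c * √(1 + (c⁻¹) ^ 2) < -1 := by
      rw [← div_lt_iff_of_neg' hc]
      refine (lt_sqrt ?_).2 ?_
      · exact div_nonneg_of_nonpos (by norm_num) hc.le
      · rw [div_pow, inv_pow]; norm_num
    simpa [hp] using this

theorem piGaussian_eq_toSphere_mul [Nontrivial E] {C : Set E} (hC : MeasurableSet C)
    (hcone : ∀ x, ∀ r : ℝ, 0 < r → (r • x ∈ C ↔ x ∈ C)) :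
    piGaussian E C = (volume : Measure E).toSphere (Subtype.val ⁻¹' C) *
      ∫⁻ r : Set.Ioi (0 : ℝ), ENNReal.ofReal (rexp (-π * (r : ℝ) ^ 2))
        ∂(Measure.volumeIoiPow (Module.finrank ℝ E - 1)) := by
  have hCs : MeasurableSet (Subtype.val ⁻¹' C : Set (sphere (0 : E) 1)) :=
    measurable_subtype_coe hC
  have hmp := (volume : Measure E).measurePreserving_homeomorphUnitSphereProd
  have hg : Measurable fun r : Set.Ioi (0 : ℝ) => ENNReal.ofReal (rexp (-π * (r : ℝ) ^ 2)) := by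
    fun_prop
  have hind : Measurable ((Subtype.val ⁻¹' C : Set (sphere (0 : E) 1)).indicator
      (1 : sphere (0 : E) 1 → ENNReal)) := measurable_one.indicator hCs
  rw [← lintegral_indicator_one hCs, ← lintegral_prod_mul hind.aemeasurable hg.aemeasurable,
    ← hmp.lintegral_comp (by fun_prop), piGaussian, withDensity_apply _ hC,
    ← lintegral_indicator hC]
  conv_lhs => rw [← restrict_compl_singleton (μ := (volume : Measure E)) (0 : E),
    ← lintegral_subtype_comap (measurableSet_singleton _).compl]
  refine lintegral_congr fun x => ?_
  have hx : 0 < ‖(x : E)‖ := norm_pos_iff.2 x.2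
  have hmem : (‖(x : E)‖⁻¹ • (x : E)) ∈ C ↔ (x : E) ∈ C := hcone _ _ (inv_pos.2 hx)
  by_cases hxC : (x : E) ∈ C <;> simp [Set.indicator, hmem, hxC]

end StandardGaussian

theorem uniformOnSphere_eq_piGaussian {N : ℕ} (hN : 2 ≤ N) {C : Set (EuclideanSpace ℝ (Fin N))}
    (hC : MeasurableSet C) (hcone : ∀ x, ∀ r : ℝ, 0 < r → (r • x ∈ C ↔ x ∈ C)) :
    uniformOnSphere N C = piGaussian (EuclideanSpace ℝ (Fin N)) C := by
  have : Nontrivial (Fin N) := Fin.nontrivial_iff_two_le.2 hN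
  have h1 := piGaussian_eq_toSphere_mul (E := EuclideanSpace ℝ (Fin N)) MeasurableSet.univ
    (by simp)
  rw [measure_univ, Set.preimage_univ] at h1
  rw [piGaussian_eq_toSphere_mul hC hcone, uniformOnSphere,
    Measure.map_apply measurable_subtype_coe hC, Measure.smul_apply, smul_eq_mul,
    ENNReal.eq_inv_of_mul_eq_one_left ((mul_comm _ _).trans h1.symm), mul_comm]

theorem uniformOnSphere_chord_eq_piGaussian {N : ℕ} (hN : 2 ≤ N) {d : ℝ} (hd : 0 < d)
    {p : EuclideanSpace ℝ (Fin N)} (hp : ‖p‖ = 1) :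
    uniformOnSphere N {x | ‖x - p‖ ≤ d} =
      piGaussian (EuclideanSpace ℝ (Fin N)) (circularCone (1 - d ^ 2 / 2) p) := by
  have hC := measurableSet_circularCone (1 - d ^ 2 / 2) p
  rw [← uniformOnSphere_eq_piGaussian hN hC, uniformOnSphere,
    Measure.map_apply measurable_subtype_coe hC, Measure.map_apply measurable_subtype_coe
      (isClosed_le (by fun_prop) (by fun_prop)).measurableSet]
  · congr 1
    ext ⟨x, hx⟩
    have hx1 : ‖x‖ = 1 := by simpa using hx
    have h := norm_sub_sq_real x p
    simp only [circularCone, Set.mem_preimage, Set.mem_ofPred_eq]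
    rw [← sq_le_sq₀ (norm_nonneg _) hd.le, h, hx1, hp]
    constructor <;> intro <;> linarith
  · intro x r hr
    simp only [circularCone, Set.mem_ofPred_eq]
    rw [norm_smul, norm_of_nonneg hr.le, real_inner_smul_left, mul_left_comm,
      mul_le_mul_iff_right₀ hr]

theorem piGaussian_circularCone_euclidean_strictAnti {c : ℝ} (hc : 0 < c) (hc1 : c < 1)
    {N₁ N₂ : ℕ} (hN₁ : 1 ≤ N₁) (hN : N₁ < N₂)
    {p₁ : EuclideanSpace ℝ (Fin N₁)} (hp₁ : ‖p₁‖ = 1)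
    {p₂ : EuclideanSpace ℝ (Fin N₂)} (hp₂ : ‖p₂‖ = 1) :
    piGaussian _ (circularCone c p₂) < piGaussian _ (circularCone c p₁) := by
  induction N₂, hN using Nat.le_induction with
  | base => exact piGaussian_circularCone_lt_of_pos (by simp) hc hc1 hp₁ hp₂
  | succ N hN ih =>
    have hq : ‖EuclideanSpace.single (⟨0, by lia⟩ : Fin N) (1 : ℝ)‖ = 1 := by simp
    exact (piGaussian_circularCone_lt_of_pos (by simp) hc hc1 hq hp₂).trans (ih hq)

theorem piGaussian_circularCone_euclidean_strictMono {c : ℝ} (hc : c < 0) (hc1 : -1 < c)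
    {N₁ N₂ : ℕ} (hN₁ : 1 ≤ N₁) (hN : N₁ < N₂)
    {p₁ : EuclideanSpace ℝ (Fin N₁)} (hp₁ : ‖p₁‖ = 1)
    {p₂ : EuclideanSpace ℝ (Fin N₂)} (hp₂ : ‖p₂‖ = 1) :
    piGaussian _ (circularCone c p₁) < piGaussian _ (circularCone c p₂) := by
  induction N₂, hN using Nat.le_induction with
  | base => exact piGaussian_circularCone_lt_of_neg (by simp) hc hc1 hp₁ hp₂
  | succ N hN ih =>
    have hq : ‖EuclideanSpace.single (⟨0, by lia⟩ : Fin N) (1 : ℝ)‖ = 1 := by simp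
    exact (ih hq).trans (piGaussian_circularCone_lt_of_neg (by simp) hc hc1 hq hp₂)

theorem sphere_chord_cdf_monotone_in_dim (d : ℝ) (N₁ N₂ : ℕ)
    (hN₁ : 2 ≤ N₁) (hN : N₁ < N₂)
    (p₁ : EuclideanSpace ℝ (Fin N₁)) (hp₁ : ‖p₁‖ = 1)
    (p₂ : EuclideanSpace ℝ (Fin N₂)) (hp₂ : ‖p₂‖ = 1) :
    (0 < d → d < Real.sqrt 2 →
      uniformOnSphere N₂ {x | ‖x - p₂‖ ≤ d} <
        uniformOnSphere N₁ {x | ‖x - p₁‖ ≤ d}) ∧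
    (Real.sqrt 2 < d → d < 2 →
      uniformOnSphere N₁ {x | ‖x - p₁‖ ≤ d} <
        uniformOnSphere N₂ {x | ‖x - p₂‖ ≤ d}) := by
  have hN₂ : 2 ≤ N₂ := hN₁.trans hN.le
  refine ⟨fun hd hd2 => ?_, fun hd hd2 => ?_⟩
  · rw [uniformOnSphere_chord_eq_piGaussian hN₁ hd hp₁,
      uniformOnSphere_chord_eq_piGaussian hN₂ hd hp₂]
    have := (lt_sqrt hd.le).1 hd2
    exact piGaussian_circularCone_euclidean_strictAnti (by linarith)
      (by linarith [pow_pos hd 2]) (by lia) hN hp₁ hp₂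
  · have hd0 : 0 < d := (sqrt_nonneg 2).trans_lt hd
    rw [uniformOnSphere_chord_eq_piGaussian hN₁ hd0 hp₁,
      uniformOnSphere_chord_eq_piGaussian hN₂ hd0 hp₂]
    have := (sqrt_lt' hd0).1 hd
    exact piGaussian_circularCone_euclidean_strictMono (by linarith)
      (by nlinarith) (by lia) hN hp₁ hp₂
end
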